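/- arXiv:1203.3578 — 2 statements merged into one kernel-verified Lean document; each statement's English description precedes it below -/
import Mathlib

section
/- Let V be a finite set, E a nonempty finite set of directed edges on V (parallel edges allowed), B ⊆ V, b : B → ℤ≥0, and let f be an integer-valued intersecting supermodular biset function on V. Let γ = max{|Γ(Ŝ)| : Ŝ a biset on V with f(Ŝ) > 0} (γ = 0 if no such biset exists). Then for any integer α ≥ 2 and any extreme point x* of the polytope P(f,b,E), there is an edge e ∈ E with x*(e) = 0 or x*(e) ≥ 1/α, or there is a node v ∈ B with |δ⁺_E(v)| ≤ α·b(v) + ⌈2γ/(α−1)⌉ + 1. -/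
noncomputable section

attribute [local instance] Classical.propDecidable

/-- A biset on `V`: an ordered pair of finsets `inner ⊆ outer`. -/
structure Biset (V : Type*) where
  inner : Finset V
  outer : Finset V
  subset : inner ⊆ outer

namespace Biset

variable {V : Type*} [DecidableEq V]

instance [Fintype V] : Fintype (Biset V) :=
  Fintype.ofInjective (fun A => (A.inner, A.outer))
    (fun A B h => by
      cases A; cases B
      simp only [Prod.mk.injEq] at h
      cases h.1; cases h.2; rfl)

/-- The boundary `Γ(Ŝ) = S⁺ ∖ S`. -/
def boundary (A : Biset V) : Finset V := A.outer \ A.inner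

def inter (A B : Biset V) : Biset V :=
  ⟨A.inner ∩ B.inner, A.outer ∩ B.outer, Finset.inter_subset_inter A.subset B.subset⟩

def union (A B : Biset V) : Biset V :=
  ⟨A.inner ∪ B.inner, A.outer ∪ B.outer, Finset.union_subset_union A.subset B.subset⟩

def diff (A B : Biset V) : Biset V :=
  ⟨A.inner \ B.outer, A.outer \ B.inner, Finset.sdiff_subset_sdiff A.subset B.subset⟩

/-- Biset containment: `X̂ ⊆ Ŷ` iff `X ⊆ Y` and `X⁺ ⊆ Y⁺`. -/
def Sub (A B : Biset V) : Prop := A.inner ⊆ B.inner ∧ A.outer ⊆ B.outer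

def Laminar (L : Finset (Biset V)) : Prop :=
  ∀ A ∈ L, ∀ B ∈ L, Sub A B ∨ Sub B A ∨ A.inner ∩ B.inner = ∅

def StronglyLaminar (L : Finset (Biset V)) : Prop :=
  ∀ A ∈ L, ∀ B ∈ L, Sub A B ∨ Sub B A ∨
    (A.inner ∩ B.outer = ∅ ∧ B.inner ∩ A.outer = ∅)

def IntersectingSupermodular (f : Biset V → ℤ) : Prop :=
  ∀ A B : Biset V, (A.inner ∩ B.inner).Nonempty →
    f A + f B ≤ f (inter A B) + f (union A B)

def SkewSupermodular (f : Biset V → ℤ) : Prop :=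
  ∀ A B : Biset V,
    f A + f B ≤ f (inter A B) + f (union A B) ∨
    f A + f B ≤ f (diff A B) + f (diff B A)

def vertexBiset (v : V) : Biset V := ⟨{v}, {v}, Finset.Subset.refl _⟩

end Biset

/-- `γ = max { |Γ(Ŝ)| : f(Ŝ) > 0 }` (0 if no such biset exists). -/
def gammaOf {V : Type*} [Fintype V] [DecidableEq V] (f : Biset V → ℤ) : ℕ :=
  (Finset.univ.filter fun A : Biset V => 0 < f A).sup fun A => (Biset.boundary A).card

/-- The leaves (inclusion-minimal members) of a biset family. -/
def leaves {V : Type*} (L : Finset (Biset V)) : Finset (Biset V) :=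
  L.filter fun A => ∀ B ∈ L, Biset.Sub B A → B = A

/-- `max_{Ŝ ∈ L} |Γ(Ŝ)|` (0 if `L` is empty). -/
def gammaL {V : Type*} [DecidableEq V] (L : Finset (Biset V)) : ℕ :=
  L.sup fun A => (Biset.boundary A).card

section Directed

variable {V E : Type*} [Fintype V] [DecidableEq V] [Fintype E]

/-- `δ⁻_E(Ŝ)`: edges entering the biset (tail outside outer part, head in inner part). -/
def inDelta (tail head : E → V) (A : Biset V) : Finset E :=
  Finset.univ.filter fun e => head e ∈ A.inner ∧ tail e ∉ A.outer

/-- `δ⁺_E(Ŝ)`: edges leaving the biset. -/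
def outDelta (tail head : E → V) (A : Biset V) : Finset E :=
  Finset.univ.filter fun e => tail e ∈ A.inner ∧ head e ∉ A.outer

/-- `δ⁺_E(v)`. -/
def outDeg (tail head : E → V) (v : V) : Finset E :=
  outDelta tail head (Biset.vertexBiset v)

/-- The polytope `P(f,b,E)` for directed edges. -/
def dirP (tail head : E → V) (f : Biset V → ℤ) (B : Finset V) (b : V → ℕ) :
    Set (E → ℝ) :=
  {x | (∀ e : E, 0 ≤ x e ∧ x e ≤ 1) ∧
       (∀ A : Biset V, (f A : ℝ) ≤ ∑ e ∈ inDelta tail head A, x e) ∧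
       (∀ v ∈ B, ∑ e ∈ outDeg tail head v, x e ≤ (b v : ℝ))}

/-- Incidence vector of an edge set. -/
def incVec (F : Finset E) : E → ℝ := fun e => if e ∈ F then 1 else 0

end Directed

theorem Biset.eq_of_inner_outer {V : Type*} {A B : Biset V} (h₁ : A.inner = B.inner)
    (h₂ : A.outer = B.outer) : A = B := by
  cases A; cases B; simp_all

/-- Bisets are ordered by containment of inner and outer parts. -/
instance Biset.instPartialOrder {V : Type*} : PartialOrder (Biset V) where
  le A B := A.inner ⊆ B.inner ∧ A.outer ⊆ B.outer
  le_refl A := ⟨Finset.Subset.refl _, Finset.Subset.refl _⟩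
  le_trans A B C h₁ h₂ := ⟨h₁.1.trans h₂.1, h₁.2.trans h₂.2⟩
  le_antisymm A B h₁ h₂ :=
    Biset.eq_of_inner_outer (h₁.1.antisymm h₂.1) (h₁.2.antisymm h₂.2)

section Forest

variable {β : Type*} [PartialOrder β]

/-- The maximal members of `L` strictly below `S`. -/
def childrenIn (L : Finset β) (S : β) : Finset β :=
  L.filter fun R => R < S ∧ ∀ Q ∈ L, R < Q → ¬ Q < S

theorem mem_childrenIn {L : Finset β} {R S : β} :
    R ∈ childrenIn L S ↔ R ∈ L ∧ R < S ∧ ∀ Q ∈ L, R < Q → ¬ Q < S := by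
  simp [childrenIn]

theorem exists_le_mem_childrenIn {L : Finset β} {P S : β} (hP : P ∈ L) (hPS : P < S) :
    ∃ R ∈ childrenIn L S, P ≤ R := by
  obtain ⟨R, hPR, hR⟩ := (L.filter (· < S)).exists_le_maximal (a := P) (by simp [hP, hPS])
  have hm := hR.prop
  simp only [Finset.mem_filter] at hm
  refine ⟨R, mem_childrenIn.2 ⟨hm.1, hm.2, fun Q hQ hRQ hQS => ?_⟩, hPR⟩
  exact hR.not_gt (by simp [hQ, hQS]) hRQ

theorem exists_childrenIn_of_lt {L : Finset β} {R P : β} (hR : R ∈ L) (hP : P ∈ L)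
    (h : R < P) : ∃ S ∈ L, R ∈ childrenIn L S := by
  obtain ⟨S, -, hS⟩ := (L.filter (R < ·)).exists_le_minimal (a := P) (by simp [hP, h])
  have hm := hS.prop
  simp only [Finset.mem_filter] at hm
  refine ⟨S, hm.1, mem_childrenIn.2 ⟨hR, hm.2, fun Q hQ hRQ hQS => ?_⟩⟩
  exact hS.not_lt (by simp [hQ, hRQ]) hQS

/-- Any two members of `L` with a common lower bound in `L` are comparable. -/
def IsForest (L : Finset β) : Prop :=
  ∀ R ∈ L, ∀ S ∈ L, ∀ S' ∈ L, R ≤ S → R ≤ S' → S ≤ S' ∨ S' ≤ S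

theorem IsForest.pairwiseDisjoint_childrenIn {L : Finset β} (hL : IsForest L) :
    (L : Set β).PairwiseDisjoint (childrenIn L) := by
  intro S hS S' hS' hne
  rw [Function.onFun, Finset.disjoint_left]
  intro R hR hR'
  rw [mem_childrenIn] at hR hR'
  rcases hL R hR.1 S hS S' hS' hR.2.1.le hR'.2.1.le with h | h
  · exact hR'.2.2 S hS hR.2.1 (lt_of_le_of_ne h hne)
  · exact hR.2.2 S' hS' hR'.2.1 (lt_of_le_of_ne h hne.symm)

/-- Members of `L` with no children. -/
def leafPart (L : Finset β) : Finset β := L.filter fun S => (childrenIn L S).card = 0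

/-- Members of `L` with exactly one child. -/
def unaryPart (L : Finset β) : Finset β := L.filter fun S => (childrenIn L S).card = 1

/-- Members of `L` with at least two children. -/
def branchPart (L : Finset β) : Finset β := L.filter fun S => 2 ≤ (childrenIn L S).card

theorem sum_forest_parts (L : Finset β) (g : β → ℝ) :
    ∑ S ∈ L, g S =
      ∑ S ∈ leafPart L, g S + ∑ S ∈ unaryPart L, g S + ∑ S ∈ branchPart L, g S := by
  simp only [leafPart, unaryPart, branchPart, Finset.sum_filter, ← Finset.sum_add_distrib]
  refine Finset.sum_congr rfl fun S _ => ?_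
  rcases h : (childrenIn L S).card with _ | _ | n <;> simp

theorem card_forest_parts (L : Finset β) :
    (L.card : ℝ) = (leafPart L).card + (unaryPart L).card + (branchPart L).card := by
  simpa using sum_forest_parts L (fun _ => 1)

/-- A nonempty finite forest has fewer branching nodes than leaves. -/
theorem IsForest.card_branchPart_lt {L : Finset β} (hL : IsForest L) (hne : L.Nonempty) :
    (branchPart L).card < (leafPart L).card := by
  have h1 : (L.biUnion (childrenIn L)).card < L.card := by
    refine Finset.card_lt_card ⟨fun R hR => ?_, fun h => ?_⟩
    · obtain ⟨S, -, hR⟩ := Finset.mem_biUnion.1 hR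
      exact (mem_childrenIn.1 hR).1
    · obtain ⟨M, hM⟩ := L.exists_maximal hne
      obtain ⟨S, hS, hMS⟩ := Finset.mem_biUnion.1 (h hM.prop)
      exact hM.not_gt hS (mem_childrenIn.1 hMS).2.1
  rw [Finset.card_biUnion hL.pairwiseDisjoint_childrenIn] at h1
  have h2 := sum_forest_parts L (fun S => ((childrenIn L S).card : ℝ))
  have h3 := card_forest_parts L
  have e0 : ∑ S ∈ leafPart L, ((childrenIn L S).card : ℝ) = 0 :=
    Finset.sum_eq_zero fun S hS => by simp [(Finset.mem_filter.1 hS).2]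
  have e1 : ∑ S ∈ unaryPart L, ((childrenIn L S).card : ℝ) = (unaryPart L).card := by
    rw [Finset.sum_congr rfl (g := fun _ => (1 : ℝ))
      fun S hS => by simp [(Finset.mem_filter.1 hS).2]]
    simp
  have e2 : ((branchPart L).card : ℝ) * 2 ≤ ∑ S ∈ branchPart L, ((childrenIn L S).card : ℝ) := by
    rw [← nsmul_eq_mul]
    exact Finset.card_nsmul_le_sum _ _ _ fun S hS => by
      exact_mod_cast (Finset.mem_filter.1 hS).2
  have h4 : (∑ S ∈ L, ((childrenIn L S).card : ℝ)) < L.card := by exact_mod_cast h1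
  have : ((branchPart L).card : ℝ) < (leafPart L).card := by linarith
  exact_mod_cast this

/-- Telescoping a bounded function along the unary chains of a forest. -/
theorem IsForest.sum_unary_sub_le {L : Finset β} (hL : IsForest L) (g : β → ℝ) (c : ℝ)
    (h0 : ∀ S ∈ L, 0 ≤ g S) (hc : ∀ S ∈ L, g S ≤ c) :
    ∑ S ∈ unaryPart L, (g S - ∑ R ∈ childrenIn L S, g R) ≤
      c * ((leafPart L).card + (branchPart L).card) := by
  have hUL : unaryPart L ⊆ L := Finset.filter_subset _ _
  have hd : (unaryPart L : Set β).PairwiseDisjoint (childrenIn L) :=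
    hL.pairwiseDisjoint_childrenIn.subset (Finset.coe_subset.2 hUL)
  set N := (unaryPart L).biUnion (childrenIn L) with hN
  have hNL : N ⊆ L := fun R hR => by
    obtain ⟨S, -, hR⟩ := Finset.mem_biUnion.1 hR
    exact (mem_childrenIn.1 hR).1
  have hNcard : N.card = (unaryPart L).card := by
    rw [hN, Finset.card_biUnion hd, Finset.card_eq_sum_ones]
    exact Finset.sum_congr rfl fun S hS => (Finset.mem_filter.1 hS).2
  rw [Finset.sum_sub_distrib, ← Finset.sum_biUnion hd, ← hN]
  have h1 : ∑ S ∈ unaryPart L, g S ≤ ∑ S ∈ N, g S + ∑ S ∈ unaryPart L \ N, g S := by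
    rw [← Finset.sum_union Finset.disjoint_sdiff, Finset.union_sdiff_self_eq_union]
    exact Finset.sum_le_sum_of_subset_of_nonneg Finset.subset_union_right
      fun S hS _ => h0 S (Finset.union_subset hNL hUL hS)
  have h2 : ∑ S ∈ unaryPart L \ N, g S ≤ (L \ N).card * c := by
    calc ∑ S ∈ unaryPart L \ N, g S
        ≤ ∑ S ∈ L \ N, g S := Finset.sum_le_sum_of_subset_of_nonneg
          (Finset.sdiff_subset_sdiff hUL le_rfl) fun S hS _ => h0 S (Finset.mem_sdiff.1 hS).1
      _ ≤ (L \ N).card • c := Finset.sum_le_card_nsmul _ _ _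
          fun S hS => hc S (Finset.mem_sdiff.1 hS).1
      _ = _ := nsmul_eq_mul _ _
  have h3 : ((L \ N).card : ℝ) = (leafPart L).card + (branchPart L).card := by
    rw [Finset.cast_card_sdiff hNL, hNcard, card_forest_parts L]; ring
  rw [h3] at h2
  linarith

end Forest

section Uncrossing

variable {V : Type*} [DecidableEq V]

theorem Biset.Laminar.isForest {L : Finset (Biset V)} (hL : Biset.Laminar L)
    (hne : ∀ S ∈ L, S.inner.Nonempty) : IsForest L := by
  intro R hR S hS S' hS' h h'
  rcases hL S hS S' hS' with h1 | h1 | h1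
  · exact Or.inl h1
  · exact Or.inr h1
  · obtain ⟨v, hv⟩ := hne R hR
    exact absurd (Finset.mem_inter.2 ⟨h.1 hv, h'.1 hv⟩) (by simp [h1])

theorem Biset.Laminar.le_or_le {L : Finset (Biset V)} (hL : Biset.Laminar L) {S S' : Biset V}
    (hS : S ∈ L) (hS' : S' ∈ L) {v : V} (hv : v ∈ S.inner) (hv' : v ∈ S'.inner) :
    S ≤ S' ∨ S' ≤ S := by
  rcases hL S hS S' hS' with h1 | h1 | h1
  · exact Or.inl h1
  · exact Or.inr h1
  · exact absurd (Finset.mem_inter.2 ⟨hv, hv'⟩) (by simp [h1])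

namespace Biset

/-- Intersecting inner parts and no containment. -/
def Crosses (A B : Biset V) : Prop := (A.inner ∩ B.inner).Nonempty ∧ ¬ A ≤ B ∧ ¬ B ≤ A

theorem inter_le_left (A B : Biset V) : inter A B ≤ A :=
  ⟨Finset.inter_subset_left, Finset.inter_subset_left⟩

theorem inter_le_right (A B : Biset V) : inter A B ≤ B :=
  ⟨Finset.inter_subset_right, Finset.inter_subset_right⟩

theorem le_inter {A B C : Biset V} (h : C ≤ A) (h' : C ≤ B) : C ≤ inter A B :=
  ⟨Finset.subset_inter h.1 h'.1, Finset.subset_inter h.2 h'.2⟩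

theorem le_union_left (A B : Biset V) : A ≤ union A B :=
  ⟨Finset.subset_union_left, Finset.subset_union_left⟩

theorem le_union_right (A B : Biset V) : B ≤ union A B :=
  ⟨Finset.subset_union_right, Finset.subset_union_right⟩

theorem union_le {A B C : Biset V} (h : A ≤ C) (h' : B ≤ C) : union A B ≤ C :=
  ⟨Finset.union_subset h.1 h'.1, Finset.union_subset h.2 h'.2⟩

theorem Crosses.of_inter {L : Finset (Biset V)} (hL : Laminar L) {A B C : Biset V}
    (hB : B ∈ L) (hC : C ∈ L) (h : Crosses C (inter A B)) : Crosses C A := by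
  obtain ⟨⟨v, hv⟩, h1, h2⟩ := h
  simp only [inter, Finset.mem_inter] at hv
  obtain ⟨hvC, hvA, hvB⟩ := hv
  refine ⟨⟨v, Finset.mem_inter.2 ⟨hvC, hvA⟩⟩, fun hCA => ?_, fun hAC =>
    h2 ((inter_le_left A B).trans hAC)⟩
  rcases hL.le_or_le hC hB hvC hvB with h | h
  · exact h1 (le_inter hCA h)
  · exact h2 ((inter_le_right A B).trans h)

theorem Crosses.of_union {L : Finset (Biset V)} (hL : Laminar L) {A B C : Biset V}
    (hAB : (A.inner ∩ B.inner).Nonempty)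
    (hB : B ∈ L) (hC : C ∈ L) (h : Crosses C (union A B)) : Crosses C A := by
  obtain ⟨⟨v, hv⟩, h1, h2⟩ := h
  obtain ⟨u, hu⟩ := hAB
  simp only [Finset.mem_inter] at hu
  simp only [union, Finset.mem_inter, Finset.mem_union] at hv
  have key : ∀ w, w ∈ C.inner → w ∈ B.inner → B ≤ C := fun w hw hw' =>
    (hL.le_or_le hC hB hw hw').resolve_left fun h => h1 (h.trans (le_union_right A B))
  have hmeet : (C.inner ∩ A.inner).Nonempty := by
    rcases hv.2 with hvA | hvB
    · exact ⟨v, Finset.mem_inter.2 ⟨hv.1, hvA⟩⟩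
    · exact ⟨u, Finset.mem_inter.2 ⟨(key v hv.1 hvB).1 hu.2, hu.1⟩⟩
  exact ⟨hmeet, fun hCA => h1 (hCA.trans (le_union_left A B)), fun hAC =>
    h2 (union_le hAC (key u (hAC.1 hu.1) hu.2))⟩

theorem not_crosses_of_le {A B : Biset V} (h : A ≤ B ∨ B ≤ A) : ¬ Crosses A B :=
  fun hc => h.elim hc.2.1 hc.2.2

/-- Let `L` be a laminar subfamily of an uncrossable family that contains every member of the
family crossing no member of `L`. A property of `L` that propagates by uncrossing holds on the
whole family. -/
theorem uncrossing_induction {L : Finset (Biset V)} (hL : Laminar L)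
    (tight good : Biset V → Prop)
    (hinter : ∀ A B, tight A → tight B → (A.inner ∩ B.inner).Nonempty → tight (inter A B))
    (hunion : ∀ A B, tight A → tight B → (A.inner ∩ B.inner).Nonempty → tight (union A B))
    (hLt : ∀ A ∈ L, tight A)
    (hmax : ∀ A, tight A → (∀ C ∈ L, ¬ Crosses C A) → A ∈ L)
    (hgood : ∀ A ∈ L, good A)
    (hstep : ∀ A B, tight A → tight B → (A.inner ∩ B.inner).Nonempty →
      good B → good (inter A B) → good (union A B) → good A) :
    ∀ A, tight A → good A := by
  have main : ∀ n : ℕ, ∀ A, tight A → (L.filter fun C => Crosses C A).card = n → good A := by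
    intro n
    induction n using Nat.strong_induction_on with
    | _ n ih =>
      intro A hA hn
      by_cases h : ∀ C ∈ L, ¬ Crosses C A
      · exact hgood A (hmax A hA h)
      · push Not at h
        obtain ⟨B, hB, hBA⟩ := h
        have hAB : (A.inner ∩ B.inner).Nonempty := by rw [Finset.inter_comm]; exact hBA.1
        have hlt : ∀ D, ¬ Crosses B D → (∀ C ∈ L, Crosses C D → Crosses C A) →
            (L.filter fun C => Crosses C D).card < n := by
          intro D hD hDA
          rw [← hn]
          refine Finset.card_lt_card ⟨fun C hC => ?_, fun hsub => ?_⟩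
          · simp only [Finset.mem_filter] at hC ⊢
            exact ⟨hC.1, hDA C hC.1 hC.2⟩
          · exact hD (Finset.mem_filter.1 (hsub (Finset.mem_filter.2 ⟨hB, hBA⟩))).2
        refine hstep A B hA (hLt B hB) hAB (hgood B hB) ?_ ?_
        · exact ih _ (hlt (inter A B) (not_crosses_of_le (Or.inr (inter_le_right A B)))
            fun C hC h => h.of_inter hL hB hC) _ (hinter A B hA (hLt B hB) hAB) rfl
        · exact ih _ (hlt (union A B) (not_crosses_of_le (Or.inl (le_union_right A B)))
            fun C hC h => h.of_union hL hAB hB hC) _ (hunion A B hA (hLt B hB) hAB) rfl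
  exact fun A hA => main _ A hA rfl

theorem exists_maximal_laminar [Fintype V] (tight : Biset V → Prop) :
    ∃ L : Finset (Biset V), Laminar L ∧ (∀ A ∈ L, tight A) ∧
      ∀ A, tight A → (∀ C ∈ L, ¬ Crosses C A) → A ∈ L := by
  obtain ⟨L, hL⟩ := (Finset.univ.filter fun L : Finset (Biset V) =>
    Laminar L ∧ ∀ A ∈ L, tight A).exists_maximal
      ⟨∅, Finset.mem_filter.2 ⟨Finset.mem_univ _, by simp [Laminar]⟩⟩
  have hp := hL.prop
  simp only [Finset.mem_filter, Finset.mem_univ, true_and] at hp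
  refine ⟨L, hp.1, hp.2, fun A hA hcr => ?_⟩
  have hcmp : ∀ C ∈ L, Sub C A ∨ Sub A C ∨ C.inner ∩ A.inner = ∅ := by
    intro C hC
    by_contra hcon
    push Not at hcon
    exact hcr C hC ⟨hcon.2.2, hcon.1, hcon.2.1⟩
  have hins : insert A L ⊆ L := by
    refine hL.le_of_ge ?_ (Finset.subset_insert A L)
    simp only [Finset.mem_filter, Finset.mem_univ, true_and, Finset.forall_mem_insert]
    refine ⟨?_, hA, hp.2⟩
    intro C hC D hD
    rcases Finset.mem_insert.1 hC with hCA | hC <;> rcases Finset.mem_insert.1 hD with hDA | hD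
    · exact Or.inl (hCA.trans hDA.symm).le
    · rw [hCA]
      rcases hcmp D hD with h | h | h
      · exact Or.inr (Or.inl h)
      · exact Or.inl h
      · exact Or.inr (Or.inr (by rwa [Finset.inter_comm]))
    · exact hDA ▸ hcmp C hC
    · exact hp.1 C hC D hD
  exact hins (Finset.mem_insert_self A L)

end Biset

end Uncrossing

section Tight

variable {V E : Type*} [DecidableEq V] [Fintype E]

theorem mem_inDelta {tail head : E → V} {A : Biset V} {e : E} :
    e ∈ inDelta tail head A ↔ head e ∈ A.inner ∧ tail e ∉ A.outer := by
  simp [inDelta]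

theorem mem_outDeg {tail head : E → V} {v : V} {e : E} :
    e ∈ outDeg tail head v ↔ tail e = v ∧ head e ≠ v := by
  simp [outDeg, outDelta, Biset.vertexBiset]

/-- Edges counted in `δ⁻(A)` or `δ⁻(B)` but neither in `δ⁻(A ∩ B)` nor in `δ⁻(A ∪ B)`. -/
def crossEdges (tail head : E → V) (A B : Biset V) : Finset E :=
  Finset.univ.filter fun e =>
    (head e ∈ A.inner ∧ head e ∉ B.inner ∧ tail e ∉ A.outer ∧ tail e ∈ B.outer) ∨
    (head e ∈ B.inner ∧ head e ∉ A.inner ∧ tail e ∉ B.outer ∧ tail e ∈ A.outer)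

theorem sum_inDelta_uncross (tail head : E → V) (A B : Biset V) (y : E → ℝ) :
    ∑ e ∈ inDelta tail head A, y e + ∑ e ∈ inDelta tail head B, y e =
      ∑ e ∈ inDelta tail head (Biset.inter A B), y e +
      ∑ e ∈ inDelta tail head (Biset.union A B), y e +
      ∑ e ∈ crossEdges tail head A B, y e := by
  simp only [inDelta, crossEdges, Finset.sum_filter, ← Finset.sum_add_distrib]
  refine Finset.sum_congr rfl fun e _ => ?_
  simp only [Biset.inter, Biset.union, Finset.mem_inter, Finset.mem_union]
  by_cases h1 : head e ∈ A.inner <;> by_cases h2 : head e ∈ B.inner <;>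
    by_cases h3 : tail e ∈ A.outer <;> by_cases h4 : tail e ∈ B.outer <;>
    simp [h1, h2, h3, h4]

/-- `A` is a tight covering constraint at `x`. -/
def TightAt (tail head : E → V) (f : Biset V → ℤ) (x : E → ℝ) (A : Biset V) : Prop :=
  ∑ e ∈ inDelta tail head A, x e = f A

/-- The tight degree constraints at `x`. -/
def tightNodes (tail head : E → V) (B : Finset V) (b : V → ℕ) (x : E → ℝ) : Finset V :=
  B.filter fun v => ∑ e ∈ outDeg tail head v, x e = b v

theorem tightAt_inter_union {tail head : E → V} {f : Biset V → ℤ}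
    (hf : Biset.IntersectingSupermodular f) {x : E → ℝ} (hpos : ∀ e, 0 < x e)
    (hcov : ∀ A : Biset V, (f A : ℝ) ≤ ∑ e ∈ inDelta tail head A, x e) {A B : Biset V}
    (hA : TightAt tail head f x A) (hB : TightAt tail head f x B)
    (hAB : (A.inner ∩ B.inner).Nonempty) :
    TightAt tail head f x (Biset.inter A B) ∧ TightAt tail head f x (Biset.union A B) ∧
      crossEdges tail head A B = ∅ := by
  have h1 := sum_inDelta_uncross tail head A B x
  have h2 : (f A : ℝ) + f B ≤ f (Biset.inter A B) + f (Biset.union A B) := by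
    exact_mod_cast hf A B hAB
  have h3 := hcov (Biset.inter A B)
  have h4 := hcov (Biset.union A B)
  have h5 : 0 ≤ ∑ e ∈ crossEdges tail head A B, x e :=
    Finset.sum_nonneg fun e _ => (hpos e).le
  unfold TightAt at *
  refine ⟨by linarith, by linarith, ?_⟩
  by_contra hne
  have := Finset.sum_pos (fun e _ => hpos e) (Finset.nonempty_iff_ne_empty.2 hne)
  linarith

/-- At an extreme point with no tight bounds, the tight constraints determine all of `ℝ^E`. -/
theorem eq_zero_of_tight_sums_eq_zero [Fintype V] {tail head : E → V} {f : Biset V → ℤ}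
    {B : Finset V} {b : V → ℕ} {x : E → ℝ}
    (hx : x ∈ Set.extremePoints ℝ (dirP tail head f B b))
    (h0 : ∀ e, 0 < x e) (h1 : ∀ e, x e < 1) (y : E → ℝ)
    (hA : ∀ A, TightAt tail head f x A → ∑ e ∈ inDelta tail head A, y e = 0)
    (hv : ∀ v ∈ tightNodes tail head B b x, ∑ e ∈ outDeg tail head v, y e = 0) :
    y = 0 := by
  rw [mem_extremePoints] at hx
  obtain ⟨⟨-, hcov, hdeg⟩, hext⟩ := hx
  have hsum : ∀ (F : Finset E) (ε : ℝ),
      ∑ e ∈ F, (x + ε • y) e = ∑ e ∈ F, x e + ε * ∑ e ∈ F, y e := by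
    intro F ε
    simp [Finset.sum_add_distrib, Finset.mul_sum]
  have hcont : ∀ p q : ℝ, Filter.Tendsto (fun ε : ℝ => p + ε * q) (nhds 0) (nhds p) := by
    intro p q
    have : Continuous fun ε : ℝ => p + ε * q := by fun_prop
    simpa using this.tendsto 0
  have hev : ∀ᶠ ε in nhds (0 : ℝ), x + ε • y ∈ dirP tail head f B b := by
    refine (Filter.Eventually.and ?_ (Filter.Eventually.and ?_ ?_))
    · refine Filter.eventually_all.2 fun e => ?_
      filter_upwards [(hcont (x e) (y e)).eventually_const_lt (h0 e),
        (hcont (x e) (y e)).eventually_lt_const (h1 e)] with ε h h'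
      exact ⟨h.le, h'.le⟩
    · refine Filter.eventually_all.2 fun A => ?_
      simp only [hsum]
      by_cases ht : TightAt tail head f x A
      · exact Filter.Eventually.of_forall fun ε => by rw [hA A ht]; simpa using hcov A
      · filter_upwards [(hcont _ (∑ e ∈ inDelta tail head A, y e)).eventually_const_lt
          (lt_of_le_of_ne (hcov A) (Ne.symm ht))] with ε h using h.le
    · refine Filter.eventually_all.2 fun v => ?_
      simp only [hsum]
      by_cases hvB : v ∈ B
      · by_cases ht : ∑ e ∈ outDeg tail head v, x e = b v
        · refine Filter.Eventually.of_forall fun ε _ => ?_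
          rw [hv v (Finset.mem_filter.2 ⟨hvB, ht⟩)]
          simpa using hdeg v hvB
        · filter_upwards [(hcont _ (∑ e ∈ outDeg tail head v, y e)).eventually_lt_const
            (lt_of_le_of_ne (hdeg v hvB) ht)] with ε h _ using h.le
      · exact Filter.Eventually.of_forall fun ε h => absurd h hvB
  have hneg : Filter.Tendsto (fun ε : ℝ => -ε) (nhds 0) (nhds 0) := by
    simpa using (continuous_neg (G := ℝ)).tendsto 0
  obtain ⟨ε, ⟨hp, hm⟩, hε⟩ := (((hev.and (hneg.eventually hev)).filter_mono
    (nhdsWithin_le_nhds (s := Set.Ioi 0))).and self_mem_nhdsWithin).exists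
  have hseg : x ∈ openSegment ℝ (x + ε • y) (x + (-ε) • y) := by
    refine ⟨1 / 2, 1 / 2, by norm_num, by norm_num, by norm_num, ?_⟩
    ext e
    simp
    ring
  have h := (hext _ hp _ hm hseg).1
  have hεy : ε • y = 0 := by simpa using h
  exact (smul_eq_zero.1 hεy).resolve_left (ne_of_gt hε)

/-- Bisets `L` and nodes `T` determine `ℝ^E` when no nonzero vector has zero sums on all of their
edge sets. -/
def Determines (tail head : E → V) (L : Finset (Biset V)) (T : Finset V) : Prop :=
  ∀ y : E → ℝ, (∀ A ∈ L, ∑ e ∈ inDelta tail head A, y e = 0) →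
    (∀ v ∈ T, ∑ e ∈ outDeg tail head v, y e = 0) → y = 0

theorem Determines.card_le {tail head : E → V} {L : Finset (Biset V)} {T : Finset V}
    (h : Determines tail head L T) : Fintype.card E ≤ L.card + T.card := by
  let φ : (E → ℝ) →ₗ[ℝ] (L ⊕ T → ℝ) :=
    { toFun := fun y i => i.elim (fun A => ∑ e ∈ inDelta tail head A.1, y e)
        (fun v => ∑ e ∈ outDeg tail head v.1, y e)
      map_add' := fun y z => by
        ext i; rcases i with A | v <;> simp [Finset.sum_add_distrib]
      map_smul' := fun c y => by
        ext i; rcases i with A | v <;> simp [Finset.mul_sum] }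
  have hφ : Function.Injective φ := by
    refine (injective_iff_map_eq_zero φ).2 fun y hy => h y (fun A hA => ?_) fun v hv => ?_
    · exact congrFun hy (Sum.inl ⟨A, hA⟩)
    · exact congrFun hy (Sum.inr ⟨v, hv⟩)
  simpa using LinearMap.finrank_le_finrank_of_injective hφ

/-- An inclusion-minimal laminar family of tight bisets that, with the tight nodes, determines
`ℝ^E`. -/
theorem exists_minimal_laminar_determines [Fintype V] {tail head : E → V} {f : Biset V → ℤ}
    (hf : Biset.IntersectingSupermodular f)
    {B : Finset V} {b : V → ℕ} {x : E → ℝ}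
    (hx : x ∈ Set.extremePoints ℝ (dirP tail head f B b))
    (h0 : ∀ e, 0 < x e) (h1 : ∀ e, x e < 1) :
    ∃ L : Finset (Biset V), Biset.Laminar L ∧ (∀ A ∈ L, TightAt tail head f x A) ∧
      Determines tail head L (tightNodes tail head B b x) ∧
      ∀ S ∈ L, ¬ Determines tail head (L.erase S) (tightNodes tail head B b x) := by
  have hcov := (extremePoints_subset hx).2.1
  have hu := @tightAt_inter_union V E _ _ tail head f hf x h0 hcov
  obtain ⟨M, hM, hMt, hmax⟩ := Biset.exists_maximal_laminar (TightAt tail head f x)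
  have hdet : Determines tail head M (tightNodes tail head B b x) := by
    intro y hy hyv
    refine eq_zero_of_tight_sums_eq_zero hx h0 h1 y ?_ hyv
    refine Biset.uncrossing_induction hM (TightAt tail head f x)
      (fun A => ∑ e ∈ inDelta tail head A, y e = 0)
      (fun A B hA hB h => (hu hA hB h).1) (fun A B hA hB h => (hu hA hB h).2.1) hMt hmax hy ?_
    intro A B hA hB h hyB hyi hyu
    have := sum_inDelta_uncross tail head A B y
    rw [(hu hA hB h).2.2, Finset.sum_empty] at this
    linarith
  obtain ⟨L, hLM, hL⟩ := (Finset.univ.filter fun L : Finset (Biset V) =>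
    L ⊆ M ∧ Determines tail head L (tightNodes tail head B b x)).exists_le_minimal (a := M)
      (by simp [hdet])
  have hp := hL.prop
  simp only [Finset.mem_filter, Finset.mem_univ, true_and] at hp
  refine ⟨L, fun A hA C hC => hM A (hp.1 hA) C (hp.1 hC), fun A hA => hMt A (hp.1 hA), hp.2,
    fun S hS hdS => ?_⟩
  refine hL.not_lt ?_ (Finset.erase_ssubset hS)
  simp only [Finset.mem_filter, Finset.mem_univ, true_and]
  exact ⟨(Finset.erase_subset S L).trans hp.1, hdS⟩

end Tight

section Counting

variable {V E : Type*} [DecidableEq V] [Fintype E]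

/-- Edges covering `S` whose head lies in no smaller member of `L`. -/
def enterEdges (tail head : E → V) (L : Finset (Biset V)) (S : Biset V) : Finset E :=
  (inDelta tail head S).filter fun e => ∀ R ∈ L, R < S → head e ∉ R.inner

/-- Edges covering a child of `S` but not `S`. -/
def insideEdges (tail head : E → V) (L : Finset (Biset V)) (S : Biset V) : Finset E :=
  Finset.univ.filter fun e => tail e ∈ S.outer ∧ ∃ R ∈ childrenIn L S, e ∈ inDelta tail head R

theorem mem_enterEdges {tail head : E → V} {L : Finset (Biset V)} {S : Biset V} {e : E} :
    e ∈ enterEdges tail head L S ↔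
      e ∈ inDelta tail head S ∧ ∀ R ∈ L, R < S → head e ∉ R.inner := by
  simp [enterEdges]

theorem mem_insideEdges {tail head : E → V} {L : Finset (Biset V)} {S : Biset V} {e : E} :
    e ∈ insideEdges tail head L S ↔
      tail e ∈ S.outer ∧ ∃ R ∈ childrenIn L S, e ∈ inDelta tail head R := by
  simp [insideEdges]

theorem Biset.Laminar.disjoint_inner_of_mem_childrenIn {L : Finset (Biset V)}
    (hL : Biset.Laminar L) {S R R' : Biset V} (hR : R ∈ childrenIn L S)
    (hR' : R' ∈ childrenIn L S) (hne : R ≠ R') : Disjoint R.inner R'.inner := by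
  rw [Finset.disjoint_left]
  intro v hv hv'
  rw [mem_childrenIn] at hR hR'
  rcases hL.le_or_le hR.1 hR'.1 hv hv' with h | h
  · exact hR.2.2 R' hR'.1 (lt_of_le_of_ne h hne) hR'.2.1
  · exact hR'.2.2 R hR.1 (lt_of_le_of_ne h hne.symm) hR.2.1

theorem Biset.Laminar.sum_inDelta_sub_children {L : Finset (Biset V)} (hL : Biset.Laminar L)
    (tail head : E → V) (S : Biset V) (y : E → ℝ) :
    ∑ e ∈ inDelta tail head S, y e -
        ∑ R ∈ childrenIn L S, ∑ e ∈ inDelta tail head R, y e =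
      ∑ e ∈ enterEdges tail head L S, y e - ∑ e ∈ insideEdges tail head L S, y e := by
  have hd : (childrenIn L S : Set (Biset V)).PairwiseDisjoint (inDelta tail head) := by
    intro R hR R' hR' hne
    rw [Function.onFun, Finset.disjoint_left]
    intro e he he'
    exact Finset.disjoint_left.1 (hL.disjoint_inner_of_mem_childrenIn hR hR' hne)
      (mem_inDelta.1 he).1 (mem_inDelta.1 he').1
  have hU : (childrenIn L S).biUnion (inDelta tail head) =
      (inDelta tail head S \ enterEdges tail head L S) ∪ insideEdges tail head L S := by
    ext e
    simp only [Finset.mem_biUnion, Finset.mem_union, Finset.mem_sdiff, mem_enterEdges,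
      mem_insideEdges]
    constructor
    · rintro ⟨R, hR, he⟩
      have hR' := mem_childrenIn.1 hR
      by_cases ht : tail e ∈ S.outer
      · exact Or.inr ⟨ht, R, hR, he⟩
      · rw [mem_inDelta] at he
        exact Or.inl ⟨mem_inDelta.2 ⟨hR'.2.1.le.1 he.1, ht⟩, fun h =>
          h.2 R hR'.1 hR'.2.1 he.1⟩
    · rintro (⟨he, h⟩ | ⟨-, h⟩)
      · push Not at h
        obtain ⟨P, hP, hPS, heP⟩ := h he
        obtain ⟨R, hR, hPR⟩ := exists_le_mem_childrenIn hP hPS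
        refine ⟨R, hR, mem_inDelta.2 ⟨hPR.1 heP, fun ht => ?_⟩⟩
        exact (mem_inDelta.1 he).2 ((mem_childrenIn.1 hR).2.1.le.2 ht)
      · exact h
  have hdis : Disjoint (inDelta tail head S \ enterEdges tail head L S)
      (insideEdges tail head L S) := by
    rw [Finset.disjoint_left]
    intro e he he'
    exact (mem_inDelta.1 (Finset.mem_sdiff.1 he).1).2 (mem_insideEdges.1 he').1
  have hsub : enterEdges tail head L S ⊆ inDelta tail head S := Finset.filter_subset _ _
  rw [← Finset.sum_biUnion hd, hU, Finset.sum_union hdis, ← Finset.sum_sdiff hsub]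
  ring

theorem Biset.Laminar.pairwiseDisjoint_enterEdges {L : Finset (Biset V)}
    (hL : Biset.Laminar L) (tail head : E → V) :
    (L : Set (Biset V)).PairwiseDisjoint (enterEdges tail head L) := by
  intro S hS S' hS' hne
  rw [Function.onFun, Finset.disjoint_left]
  intro e he he'
  rw [mem_enterEdges] at he he'
  have h1 := (mem_inDelta.1 he.1).1
  have h2 := (mem_inDelta.1 he'.1).1
  rcases hL.le_or_le hS hS' h1 h2 with h | h
  · exact he'.2 S hS (lt_of_le_of_ne h hne) h1
  · exact he.2 S' hS' (lt_of_le_of_ne h hne.symm) h2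

theorem Biset.Laminar.pairwiseDisjoint_insideEdges {L : Finset (Biset V)}
    (hL : Biset.Laminar L) (tail head : E → V) :
    (L : Set (Biset V)).PairwiseDisjoint (insideEdges tail head L) := by
  have key : ∀ S ∈ L, ∀ S' ∈ L, S < S' → ∀ e, e ∈ insideEdges tail head L S →
      e ∉ insideEdges tail head L S' := by
    intro S hS S' hS' hlt e he he'
    obtain ⟨ht, R, hR, heR⟩ := mem_insideEdges.1 he
    obtain ⟨-, R', hR', heR'⟩ := mem_insideEdges.1 he'
    rw [mem_inDelta] at heR heR'
    rw [mem_childrenIn] at hR hR'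
    rcases hL.le_or_le hS hR'.1 (hR.2.1.le.1 heR.1) heR'.1 with h | h
    · exact heR'.2 (h.2 ht)
    · rcases h.lt_or_eq with h | h
      · exact hR'.2.2 S hS h hlt
      · exact heR'.2 (h ▸ ht)
  intro S hS S' hS' hne
  rw [Function.onFun, Finset.disjoint_left]
  intro e he he'
  obtain ⟨-, R, hR, heR⟩ := mem_insideEdges.1 he
  obtain ⟨-, R', hR', heR'⟩ := mem_insideEdges.1 he'
  rcases hL.le_or_le hS hS' ((mem_childrenIn.1 hR).2.1.le.1 (mem_inDelta.1 heR).1)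
    ((mem_childrenIn.1 hR').2.1.le.1 (mem_inDelta.1 heR').1) with h | h
  · exact key S hS S' hS' (lt_of_le_of_ne h hne) e he he'
  · exact key S' hS' S hS (lt_of_le_of_ne h hne.symm) e he' he

/-- The tokens received by `S` when an edge `e` pays `α * x e` at the smallest member it enters and
`1 - α * x e` where it stops covering, unless its tail is in `T`. -/
def token (tail head : E → V) (L : Finset (Biset V)) (T : Finset V) (α : ℝ) (x : E → ℝ)
    (S : Biset V) : ℝ :=
  α * ∑ e ∈ enterEdges tail head L S, x e +
    ∑ e ∈ (insideEdges tail head L S).filter (fun e => tail e ∉ T), (1 - α * x e)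

theorem Biset.Laminar.sum_token_le {L : Finset (Biset V)} (hL : Biset.Laminar L)
    (tail head : E → V) (T : Finset V) {α : ℝ} (hα : 0 ≤ α) {x : E → ℝ} (h0 : ∀ e, 0 ≤ x e)
    (h1 : ∀ e, α * x e ≤ 1) :
    ∑ S ∈ L, token tail head L T α x S +
      ∑ v ∈ T, ∑ e ∈ outDeg tail head v, (1 - α * x e) ≤ Fintype.card E := by
  have hB : (L : Set (Biset V)).PairwiseDisjoint
      fun S => (insideEdges tail head L S).filter (fun e => tail e ∉ T) :=
    fun S hS S' hS' hne => Finset.disjoint_filter_filter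
      (hL.pairwiseDisjoint_insideEdges tail head hS hS' hne)
  have hT : (T : Set V).PairwiseDisjoint (outDeg tail head) := by
    intro v _ v' _ hne
    rw [Function.onFun, Finset.disjoint_left]
    intro e he he'
    exact hne ((mem_outDeg.1 he).1.symm.trans (mem_outDeg.1 he').1)
  have hdis : Disjoint
      (L.biUnion fun S => (insideEdges tail head L S).filter (fun e => tail e ∉ T))
      (T.biUnion (outDeg tail head)) := by
    rw [Finset.disjoint_left]
    intro e he he'
    obtain ⟨S, -, heS⟩ := Finset.mem_biUnion.1 he
    obtain ⟨v, hv, hev⟩ := Finset.mem_biUnion.1 he'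
    exact (Finset.mem_filter.1 heS).2 ((mem_outDeg.1 hev).1 ▸ hv)
  simp only [token, Finset.sum_add_distrib]
  rw [← Finset.mul_sum, ← Finset.sum_biUnion (hL.pairwiseDisjoint_enterEdges tail head),
    ← Finset.sum_biUnion hB, ← Finset.sum_biUnion hT, add_assoc, ← Finset.sum_union hdis]
  have e1 : ∑ e ∈ L.biUnion (enterEdges tail head L), x e ≤ ∑ e, x e :=
    Finset.sum_le_sum_of_subset_of_nonneg (Finset.subset_univ _) fun e _ _ => h0 e
  have e2 := Finset.sum_le_sum_of_subset_of_nonneg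
    (Finset.subset_univ ((L.biUnion fun S => (insideEdges tail head L S).filter
      (fun e => tail e ∉ T)) ∪ T.biUnion (outDeg tail head)))
    (f := fun e => 1 - α * x e) fun e _ _ => by linarith [h1 e]
  have e3 : ∑ e, (1 - α * x e) = Fintype.card E - α * ∑ e, x e := by
    simp [Finset.sum_sub_distrib, Finset.mul_sum]
  have e4 := mul_le_mul_of_nonneg_left e1 hα
  linarith

theorem token_nonneg {tail head : E → V} {L : Finset (Biset V)} {T : Finset V} {α : ℝ}
    (hα : 0 ≤ α) {x : E → ℝ} (h0 : ∀ e, 0 ≤ x e) (h1 : ∀ e, α * x e ≤ 1) (S : Biset V) :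
    0 ≤ token tail head L T α x S :=
  add_nonneg (mul_nonneg hα (Finset.sum_nonneg fun e _ => h0 e))
    (Finset.sum_nonneg fun e _ => by linarith [h1 e])

/-- With no excluded tails, tightness makes tokens integral, hence at least one. -/
theorem one_le_token_empty {tail head : E → V} {L : Finset (Biset V)} (hL : Biset.Laminar L)
    {f : Biset V → ℤ} {x : E → ℝ} (hLt : ∀ A ∈ L, TightAt tail head f x A) {α : ℤ}
    (hα : 0 < α) (h0 : ∀ e, 0 < x e) (h1 : ∀ e, (α : ℝ) * x e < 1) {S : Biset V} (hS : S ∈ L)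
    (hne : (enterEdges tail head L S).Nonempty ∨ (insideEdges tail head L S).Nonempty) :
    1 ≤ token tail head L ∅ α x S := by
  have hα' : (0 : ℝ) < α := by exact_mod_cast hα
  have hint : token tail head L ∅ α x S =
      ((α * (f S - ∑ R ∈ childrenIn L S, f R) + (insideEdges tail head L S).card : ℤ) : ℝ) := by
    have h := hL.sum_inDelta_sub_children tail head S x
    rw [hLt S hS, Finset.sum_congr rfl fun R hR => hLt R (mem_childrenIn.1 hR).1] at h
    push_cast
    rw [h]
    simp [token, Finset.sum_sub_distrib, ← Finset.mul_sum]
    ring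
  have hpos : 0 < token tail head L ∅ α x S := by
    rcases hne with hne | hne
    · exact add_pos_of_pos_of_nonneg (mul_pos hα' (Finset.sum_pos (fun e _ => h0 e) hne))
        (Finset.sum_nonneg fun e _ => by linarith [h1 e])
    · refine add_pos_of_nonneg_of_pos (mul_nonneg hα'.le (Finset.sum_nonneg fun e _ => (h0 e).le))
        (Finset.sum_pos (fun e _ => by linarith [h1 e]) ?_)
      simpa using hne
  rw [hint] at hpos ⊢
  exact_mod_cast hpos

theorem le_token_of_leaf {tail head : E → V} {L : Finset (Biset V)} {T : Finset V}
    {f : Biset V → ℤ} {x : E → ℝ} {S : Biset V} (hS : S ∈ leafPart L)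
    (ht : TightAt tail head f x S) (hf : 0 < f S) {α : ℝ} (hα : 0 ≤ α)
    (h1 : ∀ e, α * x e ≤ 1) :
    α ≤ token tail head L T α x S := by
  have hc : childrenIn L S = ∅ := Finset.card_eq_zero.1 (Finset.mem_filter.1 hS).2
  have hE : enterEdges tail head L S = inDelta tail head S := by
    refine Finset.filter_true_of_mem fun e _ R hR hRS => ?_
    obtain ⟨Q, hQ, -⟩ := exists_le_mem_childrenIn hR hRS
    simp [hc] at hQ
  have hf' : (1 : ℝ) ≤ f S := by exact_mod_cast hf
  rw [token, hE, ht]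
  have : 0 ≤ ∑ e ∈ (insideEdges tail head L S).filter (fun e => tail e ∉ T), (1 - α * x e) :=
    Finset.sum_nonneg fun e _ => by linarith [h1 e]
  nlinarith

theorem token_eq_token_empty {tail head : E → V} {L : Finset (Biset V)} {T : Finset V}
    {α : ℝ} {x : E → ℝ} {S : Biset V} (h : ∀ e ∈ insideEdges tail head L S, tail e ∉ T) :
    token tail head L T α x S = token tail head L ∅ α x S := by
  simp only [token]
  rw [Finset.filter_true_of_mem h]
  simp

/-- Nodes of `T` that are in the outer part of `S` but of none of its children, counted along the
unary members of `L`. -/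
theorem sum_unary_outer_le {L : Finset (Biset V)} (hL : Biset.Laminar L)
    (hne : ∀ S ∈ L, S.inner.Nonempty) (T : Finset V) (γ : ℕ)
    (hγ : ∀ S ∈ L, S.boundary.card ≤ γ) :
    ∑ S ∈ unaryPart L, (((T ∩ S.outer).card : ℝ) -
        ∑ R ∈ childrenIn L S, ((T ∩ R.outer).card : ℝ)) ≤
      T.card + γ * ((leafPart L).card + (branchPart L).card) := by
  have hsplit : ∀ S : Biset V,
      ((T ∩ S.outer).card : ℝ) = (T ∩ S.inner).card + (T ∩ S.boundary).card := by
    intro S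
    rw [← Nat.cast_add, ← Finset.card_union_of_disjoint, ← Finset.inter_union_distrib_left,
      Biset.boundary, Finset.union_sdiff_of_subset S.subset]
    exact (Finset.disjoint_sdiff (s := S.inner) (t := S.outer)).mono
      Finset.inter_subset_right Finset.inter_subset_right
  have hb := (hL.isForest hne).sum_unary_sub_le (fun S => ((T ∩ S.boundary).card : ℝ)) γ
    (fun S _ => Nat.cast_nonneg _) (fun S hS => by
      exact_mod_cast (Finset.card_le_card Finset.inter_subset_right).trans (hγ S hS))
  have hi : ∑ S ∈ unaryPart L, (((T ∩ S.inner).card : ℝ) -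
      ∑ R ∈ childrenIn L S, ((T ∩ R.inner).card : ℝ)) ≤ T.card := by
    have hown : ∀ S ∈ unaryPart L, (((T ∩ S.inner).card : ℝ) -
        ∑ R ∈ childrenIn L S, ((T ∩ R.inner).card : ℝ)) =
        ((T ∩ S.inner).filter fun v => ∀ R ∈ L, R < S → v ∉ R.inner).card := by
      intro S hS
      obtain ⟨R, hR⟩ := Finset.card_eq_one.1 (Finset.mem_filter.1 hS).2
      have hR' : R ∈ childrenIn L S := by simp [hR]
      have hRS := mem_childrenIn.1 hR'
      have : ((T ∩ S.inner).filter fun v => ∀ R ∈ L, R < S → v ∉ R.inner) =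
          (T ∩ S.inner) \ (T ∩ R.inner) := by
        ext v
        simp only [Finset.mem_filter, Finset.mem_sdiff, Finset.mem_inter]
        refine and_congr_right fun hv =>
          ⟨fun h h' => h R hRS.1 hRS.2.1 h'.2, fun h P hP hPS hvP => ?_⟩
        obtain ⟨Q, hQ, hPQ⟩ := exists_le_mem_childrenIn hP hPS
        rw [hR, Finset.mem_singleton] at hQ
        exact h ⟨hv.1, hQ ▸ hPQ.1 hvP⟩
      rw [this, Finset.cast_card_sdiff (Finset.inter_subset_inter le_rfl hRS.2.1.le.1), hR,
        Finset.sum_singleton]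
    rw [Finset.sum_congr rfl hown, ← Nat.cast_sum, ← Finset.card_biUnion]
    · refine Nat.cast_le.2 (Finset.card_le_card fun v hv => ?_)
      obtain ⟨S, -, hS⟩ := Finset.mem_biUnion.1 hv
      exact (Finset.mem_inter.1 (Finset.mem_filter.1 hS).1).1
    · intro S hS S' hS' hne'
      rw [Function.onFun, Finset.disjoint_left]
      intro v hv hv'
      simp only [Finset.mem_filter, Finset.mem_inter] at hv hv'
      have hSL := (Finset.mem_filter.1 hS).1
      have hSL' := (Finset.mem_filter.1 hS').1
      rcases hL.le_or_le hSL hSL' hv.1.2 hv'.1.2 with h | h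
      · exact hv'.2 S hSL (lt_of_le_of_ne h hne') hv.1.2
      · exact hv.2 S' hSL' (lt_of_le_of_ne h hne'.symm) hv'.1.2
  simp only [hsplit, Finset.sum_add_distrib, Finset.sum_sub_distrib] at hb hi ⊢
  linarith

theorem one_le_token_add_of_unary {tail head : E → V} {L : Finset (Biset V)} {T : Finset V}
    {α : ℝ} (hα : 0 ≤ α) {x : E → ℝ} (h0 : ∀ e, 0 ≤ x e) (h1 : ∀ e, α * x e ≤ 1)
    {S : Biset V} (hS : S ∈ unaryPart L) (htok : 1 ≤ token tail head L ∅ α x S) :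
    1 ≤ token tail head L T α x S + (((T ∩ S.outer).card : ℝ) -
        ∑ R ∈ childrenIn L S, ((T ∩ R.outer).card : ℝ)) := by
  obtain ⟨R, hR⟩ := Finset.card_eq_one.1 (Finset.mem_filter.1 hS).2
  have hRS := mem_childrenIn.1 (show R ∈ childrenIn L S by simp [hR])
  have hsub : T ∩ R.outer ⊆ T ∩ S.outer := Finset.inter_subset_inter le_rfl hRS.2.1.le.2
  rw [hR, Finset.sum_singleton, ← Finset.cast_card_sdiff hsub]
  by_cases h : ((T ∩ S.outer) \ (T ∩ R.outer)).Nonempty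
  · have h2 : (1 : ℝ) ≤ ((T ∩ S.outer) \ (T ∩ R.outer)).card := by exact_mod_cast h.card_pos
    linarith [token_nonneg (tail := tail) (head := head) (L := L) (T := T) hα h0 h1 S]
  · rw [token_eq_token_empty]
    · exact le_add_of_le_of_nonneg htok (Nat.cast_nonneg _)
    · intro e he hT
      obtain ⟨ht, Q, hQ, heQ⟩ := mem_insideEdges.1 he
      rw [hR, Finset.mem_singleton] at hQ
      subst hQ
      exact h ⟨tail e, by simp [hT, ht, (mem_inDelta.1 heQ).2]⟩

theorem card_boundary_le_gammaOf [Fintype V] {f : Biset V → ℤ} {S : Biset V} (hS : 0 < f S) :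
    S.boundary.card ≤ gammaOf f :=
  Finset.le_sup (f := fun A : Biset V => (Biset.boundary A).card) (by simp [hS])

/-- Minimality of a determining laminar family rules out a member depending on its children. -/
theorem nonempty_of_not_determines_erase {tail head : E → V} {L : Finset (Biset V)}
    (hL : Biset.Laminar L) {T : Finset V} (hdet : Determines tail head L T) {S : Biset V}
    (hmin : ¬ Determines tail head (L.erase S) T) :
    (enterEdges tail head L S).Nonempty ∨ (insideEdges tail head L S).Nonempty := by
  by_contra h
  push Not at h
  refine hmin fun y hy hyT => hdet y (fun A hA => ?_) hyT
  by_cases hAS : A = S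
  · subst hAS
    have hid := hL.sum_inDelta_sub_children tail head A y
    rw [h.1, h.2, Finset.sum_eq_zero fun R hR => hy R (Finset.mem_erase.2
      ⟨(mem_childrenIn.1 hR).2.1.ne, (mem_childrenIn.1 hR).1⟩)] at hid
    simpa using hid
  · exact hy A (Finset.mem_erase.2 ⟨hAS, hA⟩)

theorem inDelta_nonempty_of_not_determines_erase {tail head : E → V} {L : Finset (Biset V)}
    {T : Finset V} (hdet : Determines tail head L T) {S : Biset V}
    (hmin : ¬ Determines tail head (L.erase S) T) : (inDelta tail head S).Nonempty := by
  by_contra h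
  rw [Finset.not_nonempty_iff_eq_empty] at h
  refine hmin fun y hy hyT => hdet y (fun A hA => ?_) hyT
  by_cases hAS : A = S
  · rw [hAS, h, Finset.sum_empty]
  · exact hy A (Finset.mem_erase.2 ⟨hAS, hA⟩)

end Counting

theorem stmt_0 {V E : Type*} [Fintype V] [DecidableEq V] [Fintype E] [Nonempty E]
    (tail head : E → V) (B : Finset V) (b : V → ℕ)
    (f : Biset V → ℤ) (hf : Biset.IntersectingSupermodular f)
    (α : ℤ) (hα : 2 ≤ α)
    (x : E → ℝ) (hx : x ∈ Set.extremePoints ℝ (dirP tail head f B b)) :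
    (∃ e : E, x e = 0) ∨ (∃ e : E, 1 / (α : ℝ) ≤ x e) ∨
    (∃ v ∈ B, ((outDeg tail head v).card : ℤ) ≤
      α * (b v : ℤ) + ⌈(2 * (gammaOf f : ℝ)) / ((α : ℝ) - 1)⌉ + 1) := by
  by_contra hcon
  push Not at hcon
  obtain ⟨hne0, hlt, hdeg⟩ := hcon
  have hαR : (2 : ℝ) ≤ α := by exact_mod_cast hα
  have hα0 : (0 : ℝ) < α := by linarith
  have h0 : ∀ e, 0 < x e := fun e =>
    lt_of_le_of_ne ((extremePoints_subset hx).1 e).1 (Ne.symm (hne0 e))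
  have hαx : ∀ e, (α : ℝ) * x e < 1 := fun e => by
    have := (lt_div_iff₀ hα0).1 (hlt e)
    linarith
  have h1 : ∀ e, x e < 1 := fun e => by nlinarith [hαx e, h0 e]
  obtain ⟨L, hL, hLt, hdet, hmin⟩ := exists_minimal_laminar_determines hf hx h0 h1
  set T := tightNodes tail head B b x with hT
  have hcard : (Fintype.card E : ℝ) ≤ L.card + T.card := by exact_mod_cast hdet.card_le
  have hin : ∀ S ∈ L, (inDelta tail head S).Nonempty := fun S hS =>
    inDelta_nonempty_of_not_determines_erase hdet (hmin S hS)
  have hinner : ∀ S ∈ L, S.inner.Nonempty := fun S hS => by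
    obtain ⟨e, he⟩ := hin S hS
    exact ⟨head e, (mem_inDelta.1 he).1⟩
  have hfpos : ∀ S ∈ L, 0 < f S := fun S hS => by
    have h := Finset.sum_pos (fun e _ => h0 e) (hin S hS)
    rw [hLt S hS] at h
    exact_mod_cast h
  have htok : ∀ S ∈ L, 1 ≤ token tail head L ∅ α x S := fun S hS =>
    one_le_token_empty hL hLt (by omega) h0 hαx hS
      (nonempty_of_not_determines_erase hL hdet (hmin S hS))
  have hleaf : ∀ T' : Finset V,
      ((leafPart L).card : ℝ) * α ≤ ∑ S ∈ leafPart L, token tail head L T' α x S := by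
    intro T'
    rw [← nsmul_eq_mul]
    refine Finset.card_nsmul_le_sum _ _ _ fun S hS => ?_
    have hSL := (Finset.mem_filter.1 hS).1
    exact le_token_of_leaf hS (hLt S hSL) (hfpos S hSL) hα0.le fun e => (hαx e).le
  have hparts := card_forest_parts L
  have hfirst : ((leafPart L).card : ℝ) * (α - 1) ≤ T.card := by
    have htot := hL.sum_token_le tail head ∅ hα0.le (fun e => (h0 e).le) fun e => (hαx e).le
    rw [Finset.sum_empty, add_zero, sum_forest_parts] at htot
    have hU : ((unaryPart L).card : ℝ) ≤ ∑ S ∈ unaryPart L, token tail head L ∅ α x S := by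
      simpa using Finset.card_nsmul_le_sum (unaryPart L) _ (1 : ℝ)
        fun S hS => htok S (Finset.mem_filter.1 hS).1
    have hB : ((branchPart L).card : ℝ) ≤ ∑ S ∈ branchPart L, token tail head L ∅ α x S := by
      simpa using Finset.card_nsmul_le_sum (branchPart L) _ (1 : ℝ)
        fun S hS => htok S (Finset.mem_filter.1 hS).1
    linarith [hleaf ∅]
  have hnode : (T.card : ℝ) * (2 + 2 * (gammaOf f : ℝ) / ((α : ℝ) - 1)) ≤
      ∑ v ∈ T, ∑ e ∈ outDeg tail head v, (1 - α * x e) := by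
    rw [← nsmul_eq_mul]
    refine Finset.card_nsmul_le_sum _ _ _ fun v hv => ?_
    obtain ⟨hvB, hvt⟩ := Finset.mem_filter.1 hv
    have hd : α * (b v : ℤ) + ⌈(2 * (gammaOf f : ℝ)) / ((α : ℝ) - 1)⌉ + 2 ≤
        ((outDeg tail head v).card : ℤ) := by linarith [Int.add_one_le_of_lt (hdeg v hvB)]
    have hd' : (α : ℝ) * b v + ⌈(2 * (gammaOf f : ℝ)) / ((α : ℝ) - 1)⌉ + 2 ≤
        (outDeg tail head v).card := by exact_mod_cast hd
    rw [Finset.sum_sub_distrib, ← Finset.mul_sum, hvt]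
    simp only [Finset.sum_const, nsmul_eq_mul, mul_one]
    linarith [Int.le_ceil ((2 * (gammaOf f : ℝ)) / ((α : ℝ) - 1))]
  have hsecond := hL.sum_token_le tail head T hα0.le (fun e => (h0 e).le) fun e => (hαx e).le
  rw [sum_forest_parts] at hsecond
  have hbranch : 0 ≤ ∑ S ∈ branchPart L, token tail head L T α x S :=
    Finset.sum_nonneg fun S _ => token_nonneg hα0.le (fun e => (h0 e).le) (fun e => (hαx e).le) S
  have hunary : ((unaryPart L).card : ℝ) ≤ ∑ S ∈ unaryPart L, token tail head L T α x S +
      (T.card + gammaOf f * ((leafPart L).card + (branchPart L).card)) := by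
    refine le_trans ?_ (add_le_add_right (sum_unary_outer_le hL hinner T (gammaOf f)
      fun S hS => card_boundary_le_gammaOf (hfpos S hS)) _)
    rw [← Finset.sum_add_distrib]
    simpa using Finset.card_nsmul_le_sum (unaryPart L) _ (1 : ℝ) fun S hS =>
      one_le_token_add_of_unary (T := T) hα0.le (fun e => (h0 e).le) (fun e => (hαx e).le) hS
        (htok S (Finset.mem_filter.1 hS).1)
  have hγ : (gammaOf f : ℝ) * (2 * (leafPart L).card) ≤
      T.card * (2 * (gammaOf f : ℝ) / ((α : ℝ) - 1)) := by
    rw [← mul_div_assoc, le_div_iff₀ (by linarith)]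
    nlinarith [(gammaOf f).cast_nonneg (α := ℝ)]
  have hEpos : (0 : ℝ) < Fintype.card E := by exact_mod_cast Fintype.card_pos
  rcases L.eq_empty_or_nonempty with hLe | hLne
  · have hS0 : ∀ P : Finset (Biset V), P ⊆ L → P = ∅ := fun P hP => by
      rw [hLe] at hP; exact Finset.subset_empty.1 hP
    have hl : leafPart L = ∅ := hS0 _ (Finset.filter_subset _ _)
    have hu : unaryPart L = ∅ := hS0 _ (Finset.filter_subset _ _)
    have hb : branchPart L = ∅ := hS0 _ (Finset.filter_subset _ _)
    rw [hl] at hγ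
    rw [hl, hu, hb] at hsecond
    simp only [hLe, Finset.card_empty, Finset.sum_empty, Nat.cast_zero] at hcard hsecond hγ
    linarith
  · have hlt' := (hL.isForest hinner).card_branchPart_lt hLne
    have hltR : ((branchPart L).card : ℝ) < (leafPart L).card := by exact_mod_cast hlt'
    have hγ0 : (0 : ℝ) ≤ gammaOf f := Nat.cast_nonneg _
    have hm : (gammaOf f : ℝ) * ((leafPart L).card + (branchPart L).card) ≤
        gammaOf f * (2 * (leafPart L).card) := mul_le_mul_of_nonneg_left (by linarith) hγ0
    have hm2 : ((leafPart L).card : ℝ) * 2 ≤ (leafPart L).card * α :=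
      mul_le_mul_of_nonneg_left hαR (Nat.cast_nonneg _)
    linarith [hleaf T]
end
end

section
/- Let V be a finite set, E a nonempty finite set of undirected edges on V (parallel edges allowed), B ⊆ V, b : B → ℤ≥0, and let f be an integer-valued skew supermodular biset function on V. Let γ = max{|Γ(Ŝ)| : Ŝ a biset on V with f(Ŝ) > 0} (γ = 0 if no such biset exists). Then for any integer α ≥ 4 and any extreme point x* of the polytope P(f,b,E), there is an edge e ∈ E with x*(e) = 0 or x*(e) ≥ 1/α, or there is a node v ∈ B with |δ_E(v)| ≤ ⌈4(γ+2)/(α−2)⌉ + 5. -/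
noncomputable section

attribute [local instance] Classical.propDecidable

section Undirected

variable {V E : Type*} [Fintype V] [DecidableEq V] [Fintype E]

/-- `δ_E(Ŝ)`: undirected edges covering the biset
(one end-node in the inner part, the other outside the outer part). -/
def uDelta (ep1 ep2 : E → V) (A : Biset V) : Finset E :=
  Finset.univ.filter fun e =>
    (ep1 e ∈ A.inner ∧ ep2 e ∉ A.outer) ∨ (ep2 e ∈ A.inner ∧ ep1 e ∉ A.outer)

/-- `δ_E(v) = δ_E(({v},{v}))`. -/
def uDeg (ep1 ep2 : E → V) (v : V) : Finset E :=
  uDelta ep1 ep2 (Biset.vertexBiset v)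

/-- The polytope `P(f,b,E)` for undirected edges. -/
def undirP (ep1 ep2 : E → V) (f : Biset V → ℤ) (B : Finset V) (b : V → ℕ) :
    Set (E → ℝ) :=
  {x | (∀ e : E, 0 ≤ x e ∧ x e ≤ 1) ∧
       (∀ A : Biset V, (f A : ℝ) ≤ ∑ e ∈ uDelta ep1 ep2 A, x e) ∧
       (∀ v ∈ B, ∑ e ∈ uDeg ep1 ep2 v, x e ≤ (b v : ℝ))}

end Undirected

namespace Biset

variable {V : Type*}

theorem Sub.refl (A : Biset V) : Sub A A := ⟨subset_rfl, subset_rfl⟩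

theorem Sub.trans {A B C : Biset V} (h : Sub A B) (h' : Sub B C) : Sub A C :=
  ⟨h.1.trans h'.1, h.2.trans h'.2⟩

/-- The total size of a biset, a strictly monotone function for biset containment. -/
def size (A : Biset V) : ℕ := A.inner.card + A.outer.card

theorem Sub.eq_of_size_le {A B : Biset V} (h : Sub A B) (hs : size B ≤ size A) : A = B := by
  have h1 := Finset.card_le_card h.1
  have h2 := Finset.card_le_card h.2
  unfold size at hs
  have e1 := Finset.eq_of_subset_of_card_le h.1 (by omega)
  have e2 := Finset.eq_of_subset_of_card_le h.2 (by omega)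
  cases A; cases B; simp_all

theorem Sub.antisymm {A B : Biset V} (h : Sub A B) (h' : Sub B A) : A = B :=
  h.eq_of_size_le (Nat.add_le_add (Finset.card_le_card h'.1) (Finset.card_le_card h'.2))

variable [DecidableEq V]

/-- Two bisets are compatible if they may belong to a common strongly laminar family. -/
def Compatible (A B : Biset V) : Prop :=
  Sub A B ∨ Sub B A ∨ (A.inner ∩ B.outer = ∅ ∧ B.inner ∩ A.outer = ∅)

theorem Compatible.refl (A : Biset V) : Compatible A A := Or.inl (Sub.refl A)

theorem Compatible.symm {A B : Biset V} (h : Compatible A B) : Compatible B A := by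
  rcases h with h | h | h
  exacts [Or.inr (Or.inl h), Or.inl h, Or.inr (Or.inr h.symm)]

theorem Compatible.sub_or_sub {A B : Biset V} (h : Compatible A B) {v : V} (hA : v ∈ A.inner)
    (hB : v ∈ B.outer) : Sub A B ∨ Sub B A := by
  rcases h with h | h | h
  · exact Or.inl h
  · exact Or.inr h
  · exact absurd (Finset.mem_inter.2 ⟨hA, hB⟩) (by simp [h.1])

theorem compatible_right_inter (A B : Biset V) : Compatible B (inter A B) :=
  Or.inr (Or.inl ⟨Finset.inter_subset_right, Finset.inter_subset_right⟩)

theorem compatible_right_union (A B : Biset V) : Compatible B (union A B) :=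
  Or.inl ⟨Finset.subset_union_right, Finset.subset_union_right⟩

theorem compatible_right_diff (A B : Biset V) : Compatible B (diff A B) := by
  refine Or.inr (Or.inr ⟨?_, ?_⟩)
  · ext v; simp [diff]
  · ext v; simp [diff]

theorem compatible_left_diff (A B : Biset V) : Compatible A (diff A B) :=
  Or.inr (Or.inl ⟨Finset.sdiff_subset, Finset.sdiff_subset⟩)

theorem Compatible.inter {A B D : Biset V} (hA : Compatible D A) (hB : Compatible D B) :
    Compatible D (inter A B) := by
  simp only [Compatible, Sub, Biset.inter, Finset.subset_iff, Finset.eq_empty_iff_forall_notMem,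
    Finset.mem_inter] at *
  grind

theorem Compatible.union {A B D : Biset V} (hA : Compatible D A) (hB : Compatible D B)
    (hAB : ¬ Compatible A B) : Compatible D (union A B) := by
  simp only [Compatible, Sub, Biset.union, Finset.subset_iff, Finset.eq_empty_iff_forall_notMem,
    Finset.mem_inter, Finset.mem_union] at *
  rcases hA with hA | hA | hA <;> rcases hB with hB | hB | hB <;> grind (splits := 20)

theorem Compatible.diff {A B D : Biset V} (hA : Compatible D A) (hB : Compatible D B)
    (hAB : ¬ Compatible A B) : Compatible D (diff A B) := by
  simp only [Compatible, Sub, Biset.diff, Finset.subset_iff, Finset.eq_empty_iff_forall_notMem,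
    Finset.mem_inter, Finset.mem_sdiff] at *
  rcases hA with hA | hA | hA <;> rcases hB with hB | hB | hB <;> grind (splits := 20)

end Biset

section Uncrossing

variable {V E : Type*} [DecidableEq V] [Fintype E] (ep1 ep2 : E → V)

theorem mem_uDelta {A : Biset V} {e : E} : e ∈ uDelta ep1 ep2 A ↔
    (ep1 e ∈ A.inner ∧ ep2 e ∉ A.outer) ∨ (ep2 e ∈ A.inner ∧ ep1 e ∉ A.outer) := by
  simp [uDelta]

theorem sum_eq_sum_incVec (F : Finset E) (d : E → ℝ) :
    ∑ e ∈ F, d e = ∑ e, incVec F e * d e := by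
  simp [incVec, Finset.sum_ite_mem]

theorem incVec_inter_add_union_le (A B : Biset V) (e : E) :
    incVec (uDelta ep1 ep2 (A.inter B)) e + incVec (uDelta ep1 ep2 (A.union B)) e ≤
      incVec (uDelta ep1 ep2 A) e + incVec (uDelta ep1 ep2 B) e := by
  have h1 := @A.subset (ep1 e)
  have h2 := @A.subset (ep2 e)
  have h3 := @B.subset (ep1 e)
  have h4 := @B.subset (ep2 e)
  simp only [incVec, mem_uDelta, Biset.inter, Biset.union, Finset.mem_inter, Finset.mem_union]
  grind

theorem incVec_diff_add_diff_le (A B : Biset V) (e : E) :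
    incVec (uDelta ep1 ep2 (A.diff B)) e + incVec (uDelta ep1 ep2 (B.diff A)) e ≤
      incVec (uDelta ep1 ep2 A) e + incVec (uDelta ep1 ep2 B) e := by
  have h1 := @A.subset (ep1 e)
  have h2 := @A.subset (ep2 e)
  have h3 := @B.subset (ep1 e)
  have h4 := @B.subset (ep2 e)
  simp only [incVec, mem_uDelta, Biset.diff, Finset.mem_sdiff]
  grind

theorem sum_add_sum_eq_of_incVec_le {a b c d : Finset E}
    (h : ∀ e, incVec c e + incVec d e ≤ incVec a e + incVec b e) {x : E → ℝ}
    (hx : ∀ e, 0 < x e) (hs : ∑ e ∈ a, x e + ∑ e ∈ b, x e ≤ ∑ e ∈ c, x e + ∑ e ∈ d, x e)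
    (y : E → ℝ) : ∑ e ∈ a, y e + ∑ e ∈ b, y e = ∑ e ∈ c, y e + ∑ e ∈ d, y e := by
  rw [sum_eq_sum_incVec a, sum_eq_sum_incVec b, sum_eq_sum_incVec c, sum_eq_sum_incVec d] at hs ⊢
  simp only [← Finset.sum_add_distrib, ← add_mul] at hs ⊢
  have hle : ∀ e ∈ Finset.univ, (incVec c e + incVec d e) * x e ≤
      (incVec a e + incVec b e) * x e :=
    fun e _ => mul_le_mul_of_nonneg_right (h e) (hx e).le
  have heq := (Finset.sum_eq_sum_iff_of_le hle).1 (le_antisymm (Finset.sum_le_sum hle) hs)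
  refine Finset.sum_congr rfl fun e he => ?_
  rw [mul_right_cancel₀ (hx e).ne' (heq e he)]

/-- A biset whose constraint is tight at `x` and whose demand is positive. -/
def IsTight (f : Biset V → ℤ) (x : E → ℝ) (A : Biset V) : Prop :=
  0 < f A ∧ ∑ e ∈ uDelta ep1 ep2 A, x e = f A

variable {ep1 ep2}

theorem isTight_or_sum_eq_zero {f : Biset V → ℤ} {x : E → ℝ} (hx : ∀ e, 0 < x e)
    {A : Biset V} (h : ∑ e ∈ uDelta ep1 ep2 A, x e = f A) (y : E → ℝ) :
    IsTight ep1 ep2 f x A ∨ ∑ e ∈ uDelta ep1 ep2 A, y e = 0 := by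
  by_cases hA : 0 < f A
  · exact Or.inl ⟨hA, h⟩
  · right
    have : uDelta ep1 ep2 A = ∅ := by
      by_contra hne
      have h1 := Finset.sum_pos (fun e _ => hx e) (Finset.nonempty_iff_ne_empty.2 hne)
      rw [h] at h1
      exact hA (by exact_mod_cast h1)
    simp [this]

/-- Uncrossing two tight bisets. -/
theorem exists_isTight_uncross {f : Biset V → ℤ} (hf : Biset.SkewSupermodular f) {x : E → ℝ}
    (hx : ∀ e, 0 < x e) (hfx : ∀ A, (f A : ℝ) ≤ ∑ e ∈ uDelta ep1 ep2 A, x e) (y : E → ℝ)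
    {A B : Biset V} (hA : IsTight ep1 ep2 f x A) (hB : IsTight ep1 ep2 f x B)
    (hyA : ∑ e ∈ uDelta ep1 ep2 A, y e ≠ 0) (hyB : ∑ e ∈ uDelta ep1 ep2 B, y e = 0)
    (hAB : ¬ Biset.Compatible A B) :
    ∃ C, IsTight ep1 ep2 f x C ∧ ∑ e ∈ uDelta ep1 ep2 C, y e ≠ 0 ∧ Biset.Compatible B C ∧
      ∀ D, Biset.Compatible D A → Biset.Compatible D B → Biset.Compatible D C := by
  have key : ∀ C C' : Biset V, f A + f B ≤ f C + f C' →
      (∀ e, incVec (uDelta ep1 ep2 C) e + incVec (uDelta ep1 ep2 C') e ≤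
        incVec (uDelta ep1 ep2 A) e + incVec (uDelta ep1 ep2 B) e) →
      (IsTight ep1 ep2 f x C ∧ ∑ e ∈ uDelta ep1 ep2 C, y e ≠ 0) ∨
      (IsTight ep1 ep2 f x C' ∧ ∑ e ∈ uDelta ep1 ep2 C', y e ≠ 0) := by
    intro C C' hC hinc
    have h1 : (f A : ℝ) + f B ≤ f C + f C' := by exact_mod_cast hC
    have h2 := hfx C
    have h3 := hfx C'
    have hmod := sum_add_sum_eq_of_incVec_le hinc hx (by rw [hA.2, hB.2]; linarith)
    have hx' := hmod x
    rw [hA.2, hB.2] at hx'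
    have hy' := hmod y
    rw [hyB, add_zero] at hy'
    have t1 := isTight_or_sum_eq_zero (f := f) (A := C) hx (by linarith) y
    have t2 := isTight_or_sum_eq_zero (f := f) (A := C') hx (by linarith) y
    by_cases hz : ∑ e ∈ uDelta ep1 ep2 C, y e = 0
    · have hz' : ∑ e ∈ uDelta ep1 ep2 C', y e ≠ 0 := by
        rw [hz, zero_add] at hy'
        rwa [← hy']
      exact Or.inr ⟨t2.resolve_right hz', hz'⟩
    · exact Or.inl ⟨t1.resolve_right hz, hz⟩
  have hBA : ¬ Biset.Compatible B A := fun h => hAB h.symm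
  rcases hf A B with h | h
  · rcases key _ _ h (incVec_inter_add_union_le ep1 ep2 A B) with ⟨h1, h2⟩ | ⟨h1, h2⟩
    · exact ⟨_, h1, h2, Biset.compatible_right_inter A B, fun D hDA hDB => hDA.inter hDB⟩
    · exact ⟨_, h1, h2, Biset.compatible_right_union A B, fun D hDA hDB => hDA.union hDB hAB⟩
  · rcases key _ _ h (incVec_diff_add_diff_le ep1 ep2 A B) with ⟨h1, h2⟩ | ⟨h1, h2⟩
    · exact ⟨_, h1, h2, Biset.compatible_right_diff A B, fun D hDA hDB => hDA.diff hDB hAB⟩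
    · exact ⟨_, h1, h2, Biset.compatible_left_diff B A, fun D hDA hDB => hDB.diff hDA hBA⟩

variable [Fintype V]

/-- There is a strongly laminar family of tight bisets, with distinct incidence vectors, whose
constraints imply all tight biset constraints. -/
theorem exists_stronglyLaminar_tight {f : Biset V → ℤ} (hf : Biset.SkewSupermodular f)
    {x : E → ℝ} (hx : ∀ e, 0 < x e)
    (hfx : ∀ A, (f A : ℝ) ≤ ∑ e ∈ uDelta ep1 ep2 A, x e) :
    ∃ L : Finset (Biset V), Biset.StronglyLaminar L ∧ (∀ A ∈ L, IsTight ep1 ep2 f x A) ∧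
      (∀ A ∈ L, ∀ B ∈ L, uDelta ep1 ep2 A = uDelta ep1 ep2 B → A = B) ∧
      ∀ y : E → ℝ, (∀ A ∈ L, ∑ e ∈ uDelta ep1 ep2 A, y e = 0) →
        ∀ A, IsTight ep1 ep2 f x A → ∑ e ∈ uDelta ep1 ep2 A, y e = 0 := by
  let P : Finset (Biset V) → Prop := fun L =>
    Biset.StronglyLaminar L ∧ (∀ A ∈ L, IsTight ep1 ep2 f x A) ∧
      (∀ A ∈ L, ∀ B ∈ L, uDelta ep1 ep2 A = uDelta ep1 ep2 B → A = B)
  obtain ⟨L, hL, hmax⟩ := Finset.exists_max_image (Finset.univ.filter P) Finset.card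
    ⟨∅, Finset.mem_filter.2 ⟨Finset.mem_univ _, by simp [P, Biset.StronglyLaminar]⟩⟩
  obtain ⟨hlam, htight, hinj⟩ : P L := by simpa using hL
  refine ⟨L, hlam, htight, hinj, fun y hy => ?_⟩
  by_contra! hcon
  obtain ⟨A₀, hA₀, hy₀⟩ := hcon
  obtain ⟨A, hA, hmin⟩ := Finset.exists_min_image
    (Finset.univ.filter fun A : Biset V =>
      IsTight ep1 ep2 f x A ∧ ∑ e ∈ uDelta ep1 ep2 A, y e ≠ 0)
    (fun A => (L.filter fun D => ¬ Biset.Compatible D A).card) ⟨A₀, by simp [hA₀, hy₀]⟩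
  simp only [Finset.mem_filter, Finset.mem_univ, true_and] at hA hmin
  by_cases hcross : ∃ B ∈ L, ¬ Biset.Compatible B A
  · obtain ⟨B, hB, hBA⟩ := hcross
    obtain ⟨C, hC, hyC, hBC, hcomp⟩ := exists_isTight_uncross hf hx hfx y hA.1 (htight B hB)
      hA.2 (hy B hB) (fun h => hBA h.symm)
    refine absurd (hmin C ⟨hC, hyC⟩) (not_le.2 (Finset.card_lt_card ?_))
    refine Finset.ssubset_iff_of_subset ?_ |>.2 ⟨B, by simp [hB, hBA], by simp [hBC]⟩
    intro D hD
    simp only [Finset.mem_filter] at hD ⊢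
    exact ⟨hD.1, fun h => hD.2 (hcomp D h (hlam D hD.1 B hB))⟩
  · push Not at hcross
    have hAL : A ∉ L := fun h => hA.2 (hy A h)
    have hne : ∀ B ∈ L, uDelta ep1 ep2 A ≠ uDelta ep1 ep2 B := fun B hB h =>
      hA.2 (by rw [h]; exact hy B hB)
    have hP : P (insert A L) := by
      refine ⟨?_, ?_, ?_⟩
      · intro C hC D hD
        change Biset.Compatible C D
        rcases Finset.mem_insert.1 hC with rfl | hC' <;> rcases Finset.mem_insert.1 hD with rfl | hD'
        exacts [Biset.Compatible.refl _, (hcross D hD').symm, hcross C hC', hlam C hC' D hD']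
      · intro C hC
        rcases Finset.mem_insert.1 hC with rfl | hC
        exacts [hA.1, htight C hC]
      · intro C hC D hD h
        rcases Finset.mem_insert.1 hC with rfl | hC' <;> rcases Finset.mem_insert.1 hD with rfl | hD'
        exacts [rfl, absurd h (hne D hD'), absurd h.symm (hne C hC'), hinj C hC' D hD' h]
    have := hmax (insert A L) (by simpa using hP)
    rw [Finset.card_insert_of_notMem hAL] at this
    omega

end Uncrossing

section Forest

variable {V : Type*} [DecidableEq V]

/-- The numbers of leaves, of members with exactly one child, and of boundary entries of nodes of
`T` along single-child members, in the forest of a strongly laminar family. -/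
theorem exists_forest_decomposition (T : Finset V) (γ : ℕ) (L : Finset (Biset V))
    (hlam : Biset.StronglyLaminar L) (hne : ∀ A ∈ L, A.inner.Nonempty)
    (hγ : ∀ A ∈ L, A.boundary.card ≤ γ) :
    ∃ (Λ S R : Finset (Biset V)) (c : Biset V → Biset V),
      Λ ⊆ L ∧ S ⊆ L ∧ R ⊆ L ∧ Disjoint Λ S ∧
      (∀ A ∈ L, ∃ r ∈ R, Biset.Sub A r) ∧
      (∀ r ∈ R, ∀ A ∈ L, Biset.Sub r A → r = A) ∧
      (∀ A ∈ Λ, ∀ B ∈ L, Biset.Sub B A → B = A) ∧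
      (∀ A ∈ S, c A ∈ L ∧ c A ≠ A ∧ Biset.Sub (c A) A ∧
        ∀ B ∈ L, Biset.Sub B A → B = A ∨ Biset.Sub B (c A)) ∧
      L.card + R.card ≤ 2 * Λ.card + S.card ∧
      ∑ A ∈ S, (T ∩ (A.boundary \ (c A).outer)).card + γ * R.card ≤
        γ * Λ.card + ∑ A ∈ R, (T ∩ A.boundary).card + (T ∩ L.biUnion Biset.inner).card := by
  induction L using Finset.induction_on_max_value Biset.size with
  | empty => exact ⟨∅, ∅, ∅, id, by simp⟩
  | insert M L hM hmax ih =>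
    have hlam' : Biset.StronglyLaminar L := fun A hA B hB =>
      hlam A (Finset.mem_insert_of_mem hA) B (Finset.mem_insert_of_mem hB)
    obtain ⟨Λ, S, R, c, hΛL, hSL, hRL, hΛS, hroot, hR, hΛ, hS, hcard, hsum⟩ := ih hlam'
      (fun A hA => hne A (Finset.mem_insert_of_mem hA))
      (fun A hA => hγ A (Finset.mem_insert_of_mem hA))
    have hMmax : ∀ B ∈ L, ¬ Biset.Sub M B := fun B hB h =>
      hM (h.eq_of_size_le (hmax B hB) ▸ hB)
    have hcompat : ∀ B ∈ L, Biset.Compatible M B := fun B hB =>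
      hlam M (Finset.mem_insert_self _ _) B (Finset.mem_insert_of_mem hB)
    set K := R.filter fun r => Biset.Sub r M with hK
    have hKR : K ⊆ R := Finset.filter_subset _ _
    have hbelow : ∀ B ∈ L, Biset.Sub B M → ∃ r ∈ K, Biset.Sub B r := by
      intro B hB hBM
      obtain ⟨r, hr, hBr⟩ := hroot B hB
      obtain ⟨v, hv⟩ := hne B (Finset.mem_insert_of_mem hB)
      have := ((hcompat r (hRL hr)).sub_or_sub (hBM.1 hv) (r.subset (hBr.1 hv))).resolve_left
        (hMmax r (hRL hr))
      exact ⟨r, by simp [hK, hr, this], hBr⟩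
    have hMR : M ∉ R \ K := fun h => hM (hRL (Finset.mem_sdiff.1 h).1)
    have hcardR : (R \ K).card + K.card = R.card := Finset.card_sdiff_add_card_eq_card hKR
    have hsumR := Finset.sum_sdiff (f := fun A : Biset V => (T ∩ A.boundary).card) hKR
    have hR'L : insert M (R \ K) ⊆ insert M L :=
      Finset.insert_subset_insert _ (Finset.sdiff_subset.trans hRL)
    have hroot' : ∀ A ∈ insert M L, ∃ r ∈ insert M (R \ K), Biset.Sub A r := by
      intro A hA
      rcases Finset.mem_insert.1 hA with rfl | hA
      · exact ⟨A, Finset.mem_insert_self _ _, Biset.Sub.refl A⟩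
      · obtain ⟨r, hr, hAr⟩ := hroot A hA
        by_cases hrM : Biset.Sub r M
        · exact ⟨M, Finset.mem_insert_self _ _, hAr.trans hrM⟩
        · exact ⟨r, by simp [hK, hr, hrM], hAr⟩
    have hRmax' : ∀ r ∈ insert M (R \ K), ∀ A ∈ insert M L, Biset.Sub r A → r = A := by
      intro r hr A hA hrA
      rcases Finset.mem_insert.1 hr with rfl | hr <;> rcases Finset.mem_insert.1 hA with rfl | hA
      · rfl
      · exact absurd hrA (hMmax A hA)
      · simp only [hK, Finset.mem_sdiff, Finset.mem_filter, not_and] at hr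
        exact absurd hrA (hr.2 hr.1)
      · exact hR r (Finset.mem_sdiff.1 hr).1 A hA hrA
    have hΛ' : ∀ A ∈ Λ, ∀ B ∈ insert M L, Biset.Sub B A → B = A := by
      intro A hA B hB h
      rcases Finset.mem_insert.1 hB with rfl | hB
      · exact absurd h (hMmax A (hΛL hA))
      · exact hΛ A hA B hB h
    have hS' : ∀ A ∈ S, c A ∈ insert M L ∧ c A ≠ A ∧ Biset.Sub (c A) A ∧
        ∀ B ∈ insert M L, Biset.Sub B A → B = A ∨ Biset.Sub B (c A) := by
      intro A hA
      obtain ⟨h1, h2, h3, h4⟩ := hS A hA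
      refine ⟨Finset.mem_insert_of_mem h1, h2, h3, fun B hB h => ?_⟩
      rcases Finset.mem_insert.1 hB with rfl | hB
      · exact absurd h (hMmax A (hSL hA))
      · exact h4 B hB h
    have hΛL' := hΛL.trans (Finset.subset_insert M L)
    have hSL' := hSL.trans (Finset.subset_insert M L)
    have hMΛ : M ∉ Λ := fun h => hM (hΛL h)
    have hMS : M ∉ S := fun h => hM (hSL h)
    have hU : (T ∩ L.biUnion Biset.inner).card ≤
        (T ∩ (insert M L).biUnion Biset.inner).card :=
      Finset.card_le_card (Finset.inter_subset_inter_left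
        (Finset.biUnion_subset_biUnion_of_subset_left _ (Finset.subset_insert M L)))
    have hentry : ∀ C ∈ K, (T ∩ (M.boundary \ C.outer)).card + (T ∩ C.boundary).card +
        (T ∩ L.biUnion Biset.inner).card ≤
        (T ∩ M.boundary).card + (T ∩ (insert M L).biUnion Biset.inner).card := by
      intro C hC
      obtain ⟨hCR, hCM⟩ := Finset.mem_filter.1 hC
      have hdisj : ∀ v ∈ C.boundary, v ∉ L.biUnion Biset.inner := by
        intro v hv hvL
        obtain ⟨A, hA, hvA⟩ := Finset.mem_biUnion.1 hvL
        obtain ⟨hv1, hv2⟩ := Finset.mem_sdiff.1 hv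
        rcases (show Biset.Compatible A C from hlam' A hA C (hRL hCR)).sub_or_sub hvA hv1 with h | h
        · exact hv2 (h.1 hvA)
        · exact hv2 (hR C hCR A hA h ▸ hvA)
      have e1 : (T ∩ C.boundary).card = (T ∩ (C.boundary ∩ M.boundary)).card +
          (T ∩ (C.boundary ∩ M.inner)).card := by
        rw [← Finset.card_union_of_disjoint]
        · congr 1
          ext v
          have := @hCM.2 v
          simp only [Biset.boundary, Finset.mem_inter, Finset.mem_union, Finset.mem_sdiff]
          tauto
        · rw [Finset.disjoint_left]
          intro v
          simp only [Biset.boundary, Finset.mem_inter, Finset.mem_sdiff]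
          tauto
      have e2 : (T ∩ (M.boundary \ C.outer)).card + (T ∩ (C.boundary ∩ M.boundary)).card ≤
          (T ∩ M.boundary).card := by
        rw [← Finset.card_union_of_disjoint]
        · apply Finset.card_le_card
          intro v
          simp only [Finset.mem_inter, Finset.mem_union, Finset.mem_sdiff]
          tauto
        · rw [Finset.disjoint_left]
          intro v
          simp only [Biset.boundary, Finset.mem_inter, Finset.mem_sdiff]
          tauto
      have e3 : (T ∩ (C.boundary ∩ M.inner)).card + (T ∩ L.biUnion Biset.inner).card ≤
          (T ∩ (insert M L).biUnion Biset.inner).card := by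
        rw [← Finset.card_union_of_disjoint]
        · apply Finset.card_le_card
          intro v
          rw [Finset.biUnion_insert]
          simp only [Finset.mem_inter, Finset.mem_union]
          tauto
        · rw [Finset.disjoint_left]
          intro v
          have := hdisj v
          simp only [Finset.mem_inter]
          tauto
      omega
    rcases Finset.eq_empty_or_nonempty K with hK0 | ⟨C, hC⟩
    · refine ⟨insert M Λ, S, insert M (R \ K), c, Finset.insert_subset_insert _ hΛL, hSL', hR'L,
        Finset.disjoint_insert_left.2 ⟨hMS, hΛS⟩, hroot', hRmax', ?_, hS', ?_, ?_⟩
      · intro A hA B hB h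
        rcases Finset.mem_insert.1 hA with rfl | hA
        · rcases Finset.mem_insert.1 hB with rfl | hB
          · rfl
          · obtain ⟨r, hr, -⟩ := hbelow B hB h
            simp [hK0] at hr
        · exact hΛ' A hA B hB h
      · rw [Finset.card_insert_of_notMem hM, Finset.card_insert_of_notMem hMR,
          Finset.card_insert_of_notMem hMΛ]
        rw [hK0] at hcardR ⊢
        simp at hcardR ⊢
        omega
      · rw [Finset.card_insert_of_notMem hMR, Finset.card_insert_of_notMem hMΛ,
          Finset.sum_insert hMR, hK0]
        simp only [Finset.sdiff_empty]
        nlinarith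
    · have hentryC := hentry C hC
      have hCL : C ∈ L := hRL (hKR hC)
      have hCM : Biset.Sub C M := (Finset.mem_filter.1 hC).2
      have hKsum := Finset.add_sum_erase K (fun A : Biset V => (T ∩ A.boundary).card) hC
      have hKbound : ∑ A ∈ K.erase C, (T ∩ A.boundary).card ≤ (K.erase C).card * γ := by
        refine Finset.sum_le_card_nsmul _ _ _ fun A hA => ?_
        exact (Finset.card_le_card Finset.inter_subset_right).trans
          (hγ A (Finset.mem_insert_of_mem (hRL (hKR (Finset.mem_of_mem_erase hA)))))
      have hKcard := Finset.card_erase_add_one hC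
      have hmain : ∑ A ∈ S, (T ∩ (A.boundary \ (c A).outer)).card +
          (T ∩ (M.boundary \ C.outer)).card + γ * ((R \ K).card + 1) ≤
          γ * Λ.card + ((T ∩ M.boundary).card + ∑ A ∈ R \ K, (T ∩ A.boundary).card) +
          (T ∩ (insert M L).biUnion Biset.inner).card := by
        rw [← hcardR, ← hKcard] at hsum
        nlinarith
      by_cases hK1 : K.card = 1
      · obtain ⟨C', hC'⟩ := Finset.card_eq_one.1 hK1
        have hCC' : C' = C := by
          have := hC
          rw [hC', Finset.mem_singleton] at this
          exact this.symm
        rw [hCC'] at hC'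
        have hupd : ∀ A ∈ S, Function.update c M C A = c A := fun A hA =>
          Function.update_of_ne (fun h : A = M => hMS (h ▸ hA)) _ _
        refine ⟨Λ, insert M S, insert M (R \ K), Function.update c M C, hΛL',
          Finset.insert_subset_insert _ hSL, hR'L, Finset.disjoint_insert_right.2 ⟨hMΛ, hΛS⟩,
          hroot', hRmax', hΛ', ?_, ?_, ?_⟩
        · intro A hA
          rcases Finset.mem_insert.1 hA with rfl | hA
          · rw [Function.update_self]
            refine ⟨Finset.mem_insert_of_mem hCL, fun h => hM (h ▸ hCL), hCM, fun B hB h => ?_⟩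
            rcases Finset.mem_insert.1 hB with rfl | hB
            · exact Or.inl rfl
            · obtain ⟨r, hr, hBr⟩ := hbelow B hB h
              rw [hC', Finset.mem_singleton] at hr
              exact Or.inr (hr ▸ hBr)
          · rw [hupd A hA]
            exact hS' A hA
        · rw [Finset.card_insert_of_notMem hM, Finset.card_insert_of_notMem hMR,
            Finset.card_insert_of_notMem hMS]
          omega
        · rw [Finset.card_insert_of_notMem hMR, Finset.sum_insert hMS, Finset.sum_insert hMR,
            Function.update_self, Finset.sum_congr rfl fun A hA => by rw [hupd A hA]]
          linarith
      · refine ⟨Λ, S, insert M (R \ K), c, hΛL', hSL', hR'L, hΛS, hroot', hRmax', hΛ', hS', ?_, ?_⟩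
        · rw [Finset.card_insert_of_notMem hM, Finset.card_insert_of_notMem hMR]
          omega
        · rw [Finset.card_insert_of_notMem hMR, Finset.sum_insert hMR]
          linarith

end Forest

theorem lt_card_of_sum_eq_int {E : Type*} {a : ℕ} (ha : 0 < a) {x : E → ℝ} (hx : ∀ e, 0 < x e)
    (hxa : ∀ e, x e < 1 / (a : ℝ)) {F : Finset E} (hF : F.Nonempty) {n : ℤ}
    (hn : ∑ e ∈ F, x e = n) : a < F.card := by
  have h1 : (0 : ℝ) < n := hn ▸ Finset.sum_pos (fun e _ => hx e) hF
  have h2 : (1 : ℝ) ≤ n := by exact_mod_cast (show 0 < n by exact_mod_cast h1)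
  have h3 : ∑ e ∈ F, x e < ∑ _e ∈ F, 1 / (a : ℝ) :=
    Finset.sum_lt_sum_of_nonempty hF fun e _ => hxa e
  rw [Finset.sum_const, nsmul_eq_mul, mul_one_div, hn] at h3
  have ha' : (0 : ℝ) < a := by exact_mod_cast ha
  have h4 := h2.trans_lt h3
  rw [lt_div_iff₀ ha', one_mul] at h4
  exact_mod_cast h4

section Tokens

variable {V E : Type*} [DecidableEq V] [Fintype E] (ep1 ep2 : E → V)

/-- The end-node carrying a token, a token being an edge with a choice of one of its ends. -/
def nearEnd (p : E × Bool) : V := cond p.2 (ep1 p.1) (ep2 p.1)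

/-- The end-node opposite to the one carrying a token. -/
def farEnd (p : E × Bool) : V := cond p.2 (ep2 p.1) (ep1 p.1)

/-- Tokens of edges covering `A` but not its child `C`. -/
def startTokens (A C : Biset V) : Finset (E × Bool) :=
  Finset.univ.filter fun p =>
    nearEnd ep1 ep2 p ∈ A.inner ∧ nearEnd ep1 ep2 p ∉ C.inner ∧ farEnd ep1 ep2 p ∉ A.outer

/-- Tokens of edges covering the child `C` of `A` but not `A`. -/
def endTokens (A C : Biset V) : Finset (E × Bool) :=
  Finset.univ.filter fun p =>
    nearEnd ep1 ep2 p ∈ A.outer ∧ nearEnd ep1 ep2 p ∉ C.outer ∧ farEnd ep1 ep2 p ∈ C.inner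

/-- All tokens received by a member `A` with only child `C`. -/
def tokens (A C : Biset V) : Finset (E × Bool) :=
  startTokens ep1 ep2 A C ∪ endTokens ep1 ep2 A C

theorem card_sdiff_le_card_startTokens {A C : Biset V} (h : Biset.Sub C A) :
    (uDelta ep1 ep2 A \ uDelta ep1 ep2 C).card ≤ (startTokens ep1 ep2 A C).card := by
  refine (Finset.card_le_card ?_).trans (Finset.card_image_le (f := Prod.fst))
  intro e he
  simp only [Finset.mem_sdiff, mem_uDelta] at he
  simp only [Finset.mem_image, startTokens, Finset.mem_filter, Finset.mem_univ, true_and]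
  have h1 := @h.2 (ep1 e)
  have h2 := @h.2 (ep2 e)
  obtain ⟨h3 | h3, h4⟩ := he
  · exact ⟨(e, true), ⟨h3.1, fun hc => h4 (Or.inl ⟨hc, fun hc' => h3.2 (h2 hc')⟩), h3.2⟩, rfl⟩
  · exact ⟨(e, false), ⟨h3.1, fun hc => h4 (Or.inr ⟨hc, fun hc' => h3.2 (h1 hc')⟩), h3.2⟩, rfl⟩

theorem card_sdiff_le_card_endTokens {A C : Biset V} (h : Biset.Sub C A) :
    (uDelta ep1 ep2 C \ uDelta ep1 ep2 A).card ≤ (endTokens ep1 ep2 A C).card := by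
  refine (Finset.card_le_card ?_).trans (Finset.card_image_le (f := Prod.fst))
  intro e he
  simp only [Finset.mem_sdiff, mem_uDelta] at he
  simp only [Finset.mem_image, endTokens, Finset.mem_filter, Finset.mem_univ, true_and]
  obtain ⟨h3 | h3, h4⟩ := he
  · refine ⟨(e, false), ⟨?_, h3.2, h3.1⟩, rfl⟩
    by_contra hc
    exact h4 (Or.inl ⟨h.1 h3.1, hc⟩)
  · refine ⟨(e, true), ⟨?_, h3.2, h3.1⟩, rfl⟩
    by_contra hc
    exact h4 (Or.inr ⟨h.1 h3.1, hc⟩)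

theorem card_tokens {A C : Biset V} (h : Biset.Sub C A) :
    (tokens ep1 ep2 A C).card =
      (startTokens ep1 ep2 A C).card + (endTokens ep1 ep2 A C).card := by
  refine Finset.card_union_of_disjoint (Finset.disjoint_left.2 fun p hp hp' => ?_)
  simp only [startTokens, endTokens, Finset.mem_filter, Finset.mem_univ, true_and] at hp hp'
  exact hp.2.2 (A.subset (h.1 hp'.2.2))

theorem disjoint_tokens_of_sub {A C A' C' : Biset V} (hC : Biset.Sub C A)
    (hA : Biset.Sub A A') (hAC : Biset.Sub A C') :
    Disjoint (tokens ep1 ep2 A C) (tokens ep1 ep2 A' C') := by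
  refine Finset.disjoint_left.2 fun p hp hp' => ?_
  simp only [tokens, startTokens, endTokens, Finset.mem_union, Finset.mem_filter,
    Finset.mem_univ, true_and] at hp hp'
  rcases hp with hp | hp <;> rcases hp' with hp' | hp'
  · exact hp'.2.1 (hAC.1 hp.1)
  · exact hp'.2.1 (hAC.2 (A.subset hp.1))
  · exact hp'.2.2 (A'.subset (hA.1 (hC.1 hp.2.2)))
  · exact hp'.2.1 (hAC.2 hp.1)

theorem disjoint_tokens {A C A' C' : Biset V} (hC : Biset.Sub C A) (hC' : Biset.Sub C' A')
    (hcomp : Biset.Compatible A A') (hA : Biset.Sub A A' → Biset.Sub A C')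
    (hA' : Biset.Sub A' A → Biset.Sub A' C) :
    Disjoint (tokens ep1 ep2 A C) (tokens ep1 ep2 A' C') := by
  by_cases h : Biset.Sub A A'
  · exact disjoint_tokens_of_sub ep1 ep2 hC h (hA h)
  by_cases h' : Biset.Sub A' A
  · exact (disjoint_tokens_of_sub ep1 ep2 hC' h' (hA' h')).symm
  have hno : ∀ v, v ∈ A.inner → v ∉ A'.outer := fun v hv hv' =>
    (hcomp.sub_or_sub hv hv').elim h h'
  have hno' : ∀ v, v ∈ A'.inner → v ∉ A.outer := fun v hv hv' =>
    (hcomp.symm.sub_or_sub hv hv').elim h' h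
  refine Finset.disjoint_left.2 fun p hp hp' => ?_
  simp only [tokens, startTokens, endTokens, Finset.mem_union, Finset.mem_filter,
    Finset.mem_univ, true_and] at hp hp'
  rcases hp with hp | hp <;> rcases hp' with hp' | hp'
  · exact hno _ hp.1 (A'.subset hp'.1)
  · exact hno _ hp.1 hp'.1
  · exact hno' _ hp'.1 hp.1
  · exact hno _ (hC.1 hp.2.2) (A'.subset (hC'.1 hp'.2.2))

theorem card_uDeg_le_card_tokens (v : V) :
    (uDeg ep1 ep2 v).card ≤
      (Finset.univ.filter fun p : E × Bool => nearEnd ep1 ep2 p = v).card := by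
  refine (Finset.card_le_card ?_).trans (Finset.card_image_le (f := Prod.fst))
  intro e he
  simp only [uDeg, mem_uDelta, Biset.vertexBiset, Finset.mem_singleton] at he
  simp only [Finset.mem_image, Finset.mem_filter, Finset.mem_univ, true_and]
  rcases he with he | he
  · exact ⟨(e, true), he.1, rfl⟩
  · exact ⟨(e, false), he.1, rfl⟩

variable {ep1 ep2}

theorem card_sdiff_of_isTight {a : ℕ} (ha : 0 < a) {f : Biset V → ℤ} {x : E → ℝ}
    (hx : ∀ e, 0 < x e) (hxa : ∀ e, x e < 1 / (a : ℝ)) {A C : Biset V}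
    (hA : IsTight ep1 ep2 f x A) (hC : IsTight ep1 ep2 f x C)
    (hne : uDelta ep1 ep2 A ≠ uDelta ep1 ep2 C) :
    (0 < (uDelta ep1 ep2 A \ uDelta ep1 ep2 C).card ∧
      0 < (uDelta ep1 ep2 C \ uDelta ep1 ep2 A).card) ∨
    a < (uDelta ep1 ep2 A \ uDelta ep1 ep2 C).card ∨
    a < (uDelta ep1 ep2 C \ uDelta ep1 ep2 A).card := by
  have hsum := Finset.sum_sdiff_sub_sum_sdiff (s₁ := uDelta ep1 ep2 C) (s₂ := uDelta ep1 ep2 A)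
    (f := x)
  rw [hA.2, hC.2] at hsum
  rcases Finset.eq_empty_or_nonempty (uDelta ep1 ep2 A \ uDelta ep1 ep2 C) with h1 | h1 <;>
    rcases Finset.eq_empty_or_nonempty (uDelta ep1 ep2 C \ uDelta ep1 ep2 A) with h2 | h2
  · exact absurd (Finset.Subset.antisymm (Finset.sdiff_eq_empty_iff_subset.1 h1)
      (Finset.sdiff_eq_empty_iff_subset.1 h2)) hne
  · refine Or.inr (Or.inr (lt_card_of_sum_eq_int ha hx hxa h2 (n := f C - f A) ?_))
    rw [h1, Finset.sum_empty] at hsum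
    push_cast
    linarith
  · refine Or.inr (Or.inl (lt_card_of_sum_eq_int ha hx hxa h1 (n := f A - f C) ?_))
    rw [h2, Finset.sum_empty] at hsum
    push_cast
    linarith
  · exact Or.inl ⟨h1.card_pos, h2.card_pos⟩

/-- The tokens of `A` not carried by nodes of `T`. -/
def freeTokens (ep1 ep2 : E → V) (T : Finset V) (A C : Biset V) : Finset (E × Bool) :=
  (tokens ep1 ep2 A C).filter fun p => nearEnd ep1 ep2 p ∉ T

theorem two_le_card_freeTokens {a : ℕ} {T : Finset V} {A C : Biset V}
    (h2 : 2 ≤ (tokens ep1 ep2 A C).card)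
    (h : (0 < (startTokens ep1 ep2 A C).card ∧ 0 < (endTokens ep1 ep2 A C).card) ∨
      a < (tokens ep1 ep2 A C).card) :
    2 ≤ (freeTokens ep1 ep2 T A C).card + (T ∩ (A.boundary \ C.outer)).card +
      2 * (T ∩ (A.inner \ C.inner)).card +
      (if a < (tokens ep1 ep2 A C).card then 1 else 0) := by
  by_cases hi : (T ∩ (A.inner \ C.inner)).card = 0
  swap
  · omega
  rw [Finset.card_eq_zero, Finset.eq_empty_iff_forall_notMem] at hi
  have hstart : startTokens ep1 ep2 A C ⊆ freeTokens ep1 ep2 T A C := by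
    intro p hp
    refine Finset.mem_filter.2 ⟨Finset.mem_union_left _ hp, fun hT => ?_⟩
    simp only [startTokens, Finset.mem_filter, Finset.mem_univ, true_and] at hp
    exact hi _ (Finset.mem_inter.2 ⟨hT, Finset.mem_sdiff.2 ⟨hp.1, hp.2.1⟩⟩)
  by_cases hb : (T ∩ (A.boundary \ C.outer)).card = 0
  · rw [Finset.card_eq_zero, Finset.eq_empty_iff_forall_notMem] at hb
    have hall : tokens ep1 ep2 A C ⊆ freeTokens ep1 ep2 T A C := by
      refine Finset.union_subset hstart fun p hp => ?_
      refine Finset.mem_filter.2 ⟨Finset.mem_union_right _ hp, fun hT => ?_⟩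
      simp only [endTokens, Finset.mem_filter, Finset.mem_univ, true_and] at hp
      by_cases hpA : nearEnd ep1 ep2 p ∈ A.inner
      · exact hi _ (Finset.mem_inter.2 ⟨hT, Finset.mem_sdiff.2
          ⟨hpA, fun hc => hp.2.1 (C.subset hc)⟩⟩)
      · exact hb _ (Finset.mem_inter.2 ⟨hT, Finset.mem_sdiff.2
          ⟨Finset.mem_sdiff.2 ⟨hp.1, hpA⟩, hp.2.1⟩⟩)
    have := Finset.card_le_card hall
    omega
  · have := Finset.card_le_card hstart
    split_ifs with hexc
    · omega
    · have := (h.resolve_right hexc).1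
      omega

end Tokens

section Counting

variable {V E : Type*} [DecidableEq V] [Fintype E] {ep1 ep2 : E → V}

/-- The two token counts: one using all tokens, the other reserving the tokens at nodes of `T`.
Here `ℓ` is the number of leaves of `L` and `k` counts the members receiving many tokens. -/
theorem exists_token_bounds {a : ℕ} (ha : 4 ≤ a) {f : Biset V → ℤ} {x : E → ℝ}
    (hx : ∀ e, 0 < x e) (hxa : ∀ e, x e < 1 / (a : ℝ)) {L : Finset (Biset V)}
    (hlam : Biset.StronglyLaminar L) (htight : ∀ A ∈ L, IsTight ep1 ep2 f x A)
    (hinj : ∀ A ∈ L, ∀ B ∈ L, uDelta ep1 ep2 A = uDelta ep1 ep2 B → A = B)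
    {γ : ℕ} (hγ : ∀ A ∈ L, A.boundary.card ≤ γ) {T : Finset V} {D : ℕ}
    (hD : ∀ v ∈ T, D ≤ (uDeg ep1 ep2 v).card) (hcard : Fintype.card E ≤ L.card + T.card) :
    ∃ ℓ k : ℕ, (L.Nonempty → 0 < ℓ) ∧ (a - 1) * (ℓ + k) ≤ 2 * ℓ + 2 * T.card ∧
      D * T.card ≤ 5 * T.card + (γ + 2) * ℓ + k := by
  have hδ : ∀ A ∈ L, (uDelta ep1 ep2 A).Nonempty := by
    intro A hA
    obtain ⟨h1, h2⟩ := htight A hA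
    by_contra hne
    rw [Finset.not_nonempty_iff_eq_empty.1 hne, Finset.sum_empty] at h2
    exact h1.ne (by exact_mod_cast h2)
  have hne : ∀ A ∈ L, A.inner.Nonempty := by
    intro A hA
    obtain ⟨e, he⟩ := hδ A hA
    rcases (mem_uDelta ep1 ep2).1 he with h | h
    exacts [⟨_, h.1⟩, ⟨_, h.1⟩]
  obtain ⟨Λ, S, R, c₀, hΛL, hSL, hRL, hΛS, hroot, -, hΛ, hS, hcount, hentries⟩ :=
    exists_forest_decomposition T γ L hlam hne hγ
  let c : Biset V → Biset V := fun A => if A ∈ S then c₀ A else ⟨∅, ∅, subset_rfl⟩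
  have hcS : ∀ A ∈ S, c A = c₀ A := fun A hA => if_pos hA
  have hcΛ : ∀ A ∈ Λ, c A = ⟨∅, ∅, subset_rfl⟩ := fun A hA =>
    if_neg (Finset.disjoint_left.1 hΛS hA)
  have hN : ∀ A ∈ Λ ∪ S, A ∈ L ∧ Biset.Sub (c A) A ∧
      ∀ B ∈ L, Biset.Sub B A → B = A ∨ Biset.Sub B (c A) := by
    intro A hA
    rcases Finset.mem_union.1 hA with hA | hA
    · rw [hcΛ A hA]
      exact ⟨hΛL hA, ⟨Finset.empty_subset _, Finset.empty_subset _⟩,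
        fun B hB h => Or.inl (hΛ A hA B hB h)⟩
    · rw [hcS A hA]
      exact ⟨hSL hA, (hS A hA).2.2.1, (hS A hA).2.2.2⟩
  have hbelow : ∀ A ∈ Λ ∪ S, ∀ A' ∈ Λ ∪ S, A ≠ A' → Biset.Sub A A' → Biset.Sub A (c A') :=
    fun A hA A' hA' hAA' h => ((hN A' hA').2.2 A (hN A hA).1 h).resolve_left hAA'
  have hdisj : ∀ A ∈ Λ ∪ S, ∀ A' ∈ Λ ∪ S, A ≠ A' →
      Disjoint (tokens ep1 ep2 A (c A)) (tokens ep1 ep2 A' (c A')) := by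
    intro A hA A' hA' hAA'
    exact disjoint_tokens ep1 ep2 (hN A hA).2.1 (hN A' hA').2.1
      (hlam A (hN A hA).1 A' (hN A' hA').1) (hbelow A hA A' hA' hAA')
      (hbelow A' hA' A hA hAA'.symm)
  have hleaf : ∀ A ∈ Λ, a < (tokens ep1 ep2 A (c A)).card := by
    intro A hA
    have h1 := lt_card_of_sum_eq_int (by omega) hx hxa (hδ A (hΛL hA)) (htight A (hΛL hA)).2
    have h2 := card_sdiff_le_card_startTokens ep1 ep2 (hN A (Finset.mem_union_left _ hA)).2.1
    have h3 : uDelta ep1 ep2 (c A) = ∅ := by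
      ext e; simp [mem_uDelta, hcΛ A hA]
    rw [h3, Finset.sdiff_empty] at h2
    rw [card_tokens ep1 ep2 (hN A (Finset.mem_union_left _ hA)).2.1]
    omega
  have hmix : ∀ A ∈ Λ ∪ S, (0 < (startTokens ep1 ep2 A (c A)).card ∧
      0 < (endTokens ep1 ep2 A (c A)).card) ∨ a < (tokens ep1 ep2 A (c A)).card := by
    intro A hA
    rcases Finset.mem_union.1 hA with hA' | hA'
    · exact Or.inr (hleaf A hA')
    · have hcA := (hN A hA).2.1
      obtain ⟨h1, h2, -, -⟩ := hS A hA'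
      rw [← hcS A hA'] at h1 h2
      have h3 := card_sdiff_of_isTight (by omega) hx hxa (htight A (hSL hA')) (htight _ h1)
        (fun h => h2 (hinj _ (hSL hA') _ h1 h).symm)
      have h4 := card_sdiff_le_card_startTokens ep1 ep2 hcA
      have h5 := card_sdiff_le_card_endTokens ep1 ep2 hcA
      rw [card_tokens ep1 ep2 hcA]
      omega
  have htwo : ∀ A ∈ Λ ∪ S, 2 ≤ (tokens ep1 ep2 A (c A)).card := by
    intro A hA
    have := hmix A hA
    have := card_tokens ep1 ep2 (hN A hA).2.1
    omega
  set X := S.filter fun A => a < (tokens ep1 ep2 A (c A)).card with hX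
  have huniv : (Finset.univ : Finset (E × Bool)).card = 2 * Fintype.card E := by
    simp [mul_comm]
  have hcardN : (Λ ∪ S).card = Λ.card + S.card := Finset.card_union_of_disjoint hΛS
  have hSX : ∑ A ∈ S, (if a < (tokens ep1 ep2 A (c A)).card then 1 else 0) = X.card := by
    rw [hX, Finset.card_filter]
  have hall : ∑ A ∈ Λ ∪ S, (tokens ep1 ep2 A (c A)).card ≤ 2 * Fintype.card E := by
    rw [← huniv, ← Finset.card_biUnion hdisj]
    exact Finset.card_le_card (Finset.subset_univ _)
  refine ⟨Λ.card, X.card, ?_, ?_, ?_⟩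
  · rintro ⟨A, hA⟩
    obtain ⟨r, hr, -⟩ := hroot A hA
    have h1 : 0 < R.card := Finset.card_pos.2 ⟨r, hr⟩
    have h2 := Finset.card_le_card hSL
    omega
  · have h1 : Λ.card * (a + 1) ≤ ∑ A ∈ Λ, (tokens ep1 ep2 A (c A)).card := by
      rw [← smul_eq_mul]
      exact Finset.card_nsmul_le_sum _ _ _ fun A hA => hleaf A hA
    have h2 : 2 * S.card + (a - 1) * X.card ≤ ∑ A ∈ S, (tokens ep1 ep2 A (c A)).card := by
      rw [← hSX, Finset.mul_sum, mul_comm 2, ← smul_eq_mul, ← Finset.sum_const,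
        ← Finset.sum_add_distrib]
      refine Finset.sum_le_sum fun A hA => ?_
      have := htwo A (Finset.mem_union_right _ hA)
      split_ifs <;> omega
    rw [Finset.sum_union hΛS] at hall
    obtain ⟨d, rfl⟩ : ∃ d, a = d + 1 := ⟨a - 1, by omega⟩
    simp only [Nat.add_sub_cancel] at h2 ⊢
    nlinarith
  · have hfree : ∑ A ∈ Λ ∪ S, (freeTokens ep1 ep2 T A (c A)).card + D * T.card ≤
        2 * Fintype.card E := by
      have h1 : ∑ A ∈ Λ ∪ S, (freeTokens ep1 ep2 T A (c A)).card ≤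
          (Finset.univ.filter fun p : E × Bool => ¬ nearEnd ep1 ep2 p ∈ T).card := by
        have hd : ∀ A ∈ Λ ∪ S, ∀ A' ∈ Λ ∪ S, A ≠ A' →
            Disjoint (freeTokens ep1 ep2 T A (c A)) (freeTokens ep1 ep2 T A' (c A')) :=
          fun A hA A' hA' h => (hdisj A hA A' hA' h).mono
            (Finset.filter_subset _ _) (Finset.filter_subset _ _)
        rw [← Finset.card_biUnion hd]
        refine Finset.card_le_card (Finset.biUnion_subset.2 fun A hA p hp => ?_)
        exact Finset.mem_filter.2 ⟨Finset.mem_univ _, (Finset.mem_filter.1 hp).2⟩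
      have h2 : D * T.card ≤
          (Finset.univ.filter fun p : E × Bool => nearEnd ep1 ep2 p ∈ T).card := by
        rw [Finset.card_eq_sum_card_fiberwise (f := nearEnd ep1 ep2) (t := T)
          (fun p hp => by simpa using hp), mul_comm, ← smul_eq_mul]
        refine Finset.card_nsmul_le_sum _ _ _ fun v hv => ?_
        refine (hD v hv).trans ((card_uDeg_le_card_tokens ep1 ep2 v).trans ?_)
        refine Finset.card_le_card fun p hp => ?_
        simp only [Finset.mem_filter, Finset.mem_univ, true_and] at hp ⊢
        exact ⟨hp ▸ hv, hp⟩
      have h3 := Finset.card_filter_add_card_filter_not (s := (Finset.univ : Finset (E × Bool)))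
        (fun p => nearEnd ep1 ep2 p ∈ T)
      omega
    have hinner : ∑ A ∈ Λ ∪ S, (T ∩ (A.inner \ (c A).inner)).card ≤ T.card := by
      rw [← Finset.card_biUnion]
      · exact Finset.card_le_card (Finset.biUnion_subset.2 fun A _ => Finset.inter_subset_left)
      · intro A hA A' hA' hAA'
        refine Finset.disjoint_left.2 fun v hv hv' => ?_
        simp only [Finset.mem_inter, Finset.mem_sdiff] at hv hv'
        have hcomp : Biset.Compatible A A' := hlam A (hN A hA).1 A' (hN A' hA').1
        rcases hcomp.sub_or_sub hv.2.1 (A'.subset hv'.2.1) with h | h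
        · exact hv'.2.2 ((hbelow A hA A' hA' hAA' h).1 hv.2.1)
        · exact hv.2.2 ((hbelow A' hA' A hA hAA'.symm h).1 hv'.2.1)
    have hboundary : ∑ A ∈ S, (T ∩ (A.boundary \ (c A).outer)).card ≤ γ * Λ.card + T.card := by
      have h1 : ∑ A ∈ R, (T ∩ A.boundary).card ≤ R.card * γ :=
        Finset.sum_le_card_nsmul _ _ _ fun A hA =>
          (Finset.card_le_card Finset.inter_subset_right).trans (hγ A (hRL hA))
      have h2 : (T ∩ L.biUnion Biset.inner).card ≤ T.card :=
        Finset.card_le_card Finset.inter_subset_left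
      rw [Finset.sum_congr rfl fun A hA => by rw [hcS A hA]]
      nlinarith
    have hleaf2 : 2 * Λ.card ≤ ∑ A ∈ Λ, ((freeTokens ep1 ep2 T A (c A)).card +
        2 * (T ∩ (A.inner \ (c A).inner)).card) := by
      rw [mul_comm, ← smul_eq_mul]
      refine Finset.card_nsmul_le_sum _ _ _ fun A hA => ?_
      by_cases hi : (T ∩ (A.inner \ (c A).inner)).card = 0
      · have hsub : tokens ep1 ep2 A (c A) ⊆ freeTokens ep1 ep2 T A (c A) := by
          intro p hp
          refine Finset.mem_filter.2 ⟨hp, fun hT => ?_⟩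
          rw [Finset.card_eq_zero, Finset.eq_empty_iff_forall_notMem] at hi
          simp only [tokens, startTokens, endTokens, Finset.mem_union, Finset.mem_filter,
            Finset.mem_univ, true_and, hcΛ A hA, Finset.notMem_empty, and_false, or_false] at hp
          refine hi _ (Finset.mem_inter.2 ⟨hT, Finset.mem_sdiff.2 ⟨hp.1, ?_⟩⟩)
          simp [hcΛ A hA]
        have := Finset.card_le_card hsub
        have := htwo A (Finset.mem_union_left _ hA)
        omega
      · omega
    have hsingle2 : 2 * S.card ≤ ∑ A ∈ S, ((freeTokens ep1 ep2 T A (c A)).card +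
        (T ∩ (A.boundary \ (c A).outer)).card + 2 * (T ∩ (A.inner \ (c A).inner)).card +
        (if a < (tokens ep1 ep2 A (c A)).card then 1 else 0)) := by
      rw [mul_comm, ← smul_eq_mul]
      refine Finset.card_nsmul_le_sum _ _ _ fun A hA => ?_
      have hA' := Finset.mem_union_right Λ hA
      exact two_le_card_freeTokens (htwo A hA') (hmix A hA')
    simp only [Finset.sum_add_distrib, ← Finset.mul_sum, hSX] at hleaf2 hsingle2
    rw [Finset.sum_union hΛS] at hfree hinner
    linarith

end Counting

section ExtremePoint

variable {V E : Type*} [Fintype V] [DecidableEq V] [Fintype E] {ep1 ep2 : E → V}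

/-- At an extreme point with no tight bound constraint, the tight biset and degree constraints
have full rank. -/
theorem eq_zero_of_mem_extremePoints {f : Biset V → ℤ} {B : Finset V} {b : V → ℕ} {x : E → ℝ}
    (hx : x ∈ Set.extremePoints ℝ (undirP ep1 ep2 f B b)) (h0 : ∀ e, 0 < x e)
    (h1 : ∀ e, x e < 1) (y : E → ℝ)
    (hyf : ∀ A, ∑ e ∈ uDelta ep1 ep2 A, x e = f A → ∑ e ∈ uDelta ep1 ep2 A, y e = 0)
    (hyb : ∀ v ∈ B, ∑ e ∈ uDeg ep1 ep2 v, x e = b v → ∑ e ∈ uDeg ep1 ep2 v, y e = 0) :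
    y = 0 := by
  obtain ⟨⟨-, hxf, hxb⟩, hext⟩ := hx
  have hev : ∀ᶠ t : ℝ in nhds 0, x + t • y ∈ undirP ep1 ep2 f B b := by
    have hsum : ∀ (F : Finset E) (t : ℝ), ∑ e ∈ F, (x + t • y) e =
        ∑ e ∈ F, x e + t * ∑ e ∈ F, y e := by
      intro F t
      simp [Finset.sum_add_distrib, Finset.mul_sum]
    have hlim : ∀ p q : ℝ, Filter.Tendsto (fun t : ℝ => p + t * q) (nhds 0) (nhds p) := by
      intro p q
      have : Continuous fun t : ℝ => p + t * q := by fun_prop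
      simpa using this.tendsto 0
    have e1 : ∀ᶠ t : ℝ in nhds 0, ∀ e, 0 < x e + t * y e ∧ x e + t * y e < 1 :=
      Filter.eventually_all.2 fun e =>
        ((hlim _ _).eventually_const_lt (h0 e)).and ((hlim _ _).eventually_lt_const (h1 e))
    have e2 : ∀ᶠ t : ℝ in nhds 0, ∀ A : Biset V,
        (f A : ℝ) ≤ ∑ e ∈ uDelta ep1 ep2 A, (x + t • y) e := by
      refine Filter.eventually_all.2 fun A => ?_
      rcases (hxf A).eq_or_lt with h | h
      · refine Filter.Eventually.of_forall fun t => ?_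
        rw [hsum, hyf A h.symm, mul_zero, add_zero]
        exact hxf A
      · filter_upwards [(hlim _ _).eventually_const_lt h] with t ht
        rw [hsum]
        exact ht.le
    have e3 : ∀ᶠ t : ℝ in nhds 0, ∀ v : V, v ∈ B →
        ∑ e ∈ uDeg ep1 ep2 v, (x + t • y) e ≤ (b v : ℝ) := by
      refine Filter.eventually_all.2 fun v => ?_
      by_cases hv : v ∈ B
      swap
      · exact Filter.Eventually.of_forall fun t h => absurd h hv
      rcases (hxb v hv).eq_or_lt with h | h
      · refine Filter.Eventually.of_forall fun t _ => ?_
        rw [hsum, hyb v hv h, mul_zero, add_zero]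
        exact hxb v hv
      · filter_upwards [(hlim _ _).eventually_lt_const h] with t ht _
        rw [hsum]
        exact ht.le
    filter_upwards [e1, e2, e3] with t t1 t2 t3
    exact ⟨fun e => ⟨(t1 e).1.le, (t1 e).2.le⟩, t2, t3⟩
  obtain ⟨ε, hε, hball⟩ := Metric.eventually_nhds_iff.1 hev
  have hp := hball (y := ε / 2) (by rw [Real.dist_eq, sub_zero, abs_of_pos] <;> linarith)
  have hm := hball (y := -(ε / 2)) (by
    rw [Real.dist_eq, sub_zero, abs_neg, abs_of_pos] <;> linarith)
  have heq := hext hp hm ⟨1 / 2, 1 / 2, by norm_num, by norm_num, by norm_num, by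
    ext e; simp; ring⟩
  have : (ε / 2) • y = 0 := by simpa using heq
  exact (smul_eq_zero.1 this).resolve_left (by positivity)

theorem card_le_of_sum_eq_zero {L : Finset (Biset V)} {T : Finset V}
    (h : ∀ y : E → ℝ, (∀ A ∈ L, ∑ e ∈ uDelta ep1 ep2 A, y e = 0) →
      (∀ v ∈ T, ∑ e ∈ uDeg ep1 ep2 v, y e = 0) → y = 0) :
    Fintype.card E ≤ L.card + T.card := by
  let Φ : (E → ℝ) →ₗ[ℝ] (L ⊕ T → ℝ) :=
    { toFun := fun y => Sum.elim (fun A => ∑ e ∈ uDelta ep1 ep2 A.1, y e)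
        (fun v => ∑ e ∈ uDeg ep1 ep2 v.1, y e)
      map_add' := fun y z => by
        ext i; rcases i with i | i <;> simp [Finset.sum_add_distrib]
      map_smul' := fun r y => by
        ext i; rcases i with i | i <;> simp [Finset.mul_sum] }
  have hΦ : Function.Injective Φ := by
    refine (injective_iff_map_eq_zero Φ).2 fun y hy => h y (fun A hA => ?_) fun v hv => ?_
    · exact congrFun hy (Sum.inl ⟨A, hA⟩)
    · exact congrFun hy (Sum.inr ⟨v, hv⟩)
  simpa using LinearMap.finrank_le_finrank_of_injective hΦ

end ExtremePoint

theorem stmt_1 {V E : Type*} [Fintype V] [DecidableEq V] [Fintype E] [Nonempty E]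
    (ep1 ep2 : E → V) (B : Finset V) (b : V → ℕ)
    (f : Biset V → ℤ) (hf : Biset.SkewSupermodular f)
    (α : ℤ) (hα : 4 ≤ α)
    (x : E → ℝ) (hx : x ∈ Set.extremePoints ℝ (undirP ep1 ep2 f B b)) :
    (∃ e : E, x e = 0) ∨ (∃ e : E, 1 / (α : ℝ) ≤ x e) ∨
    (∃ v ∈ B, ((uDeg ep1 ep2 v).card : ℤ) ≤
      ⌈(4 * ((gammaOf f : ℝ) + 2)) / ((α : ℝ) - 2)⌉ + 5) := by
  by_contra! hcon
  obtain ⟨hx0, hxα, hdeg⟩ := hcon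
  lift α to ℕ using by omega with a
  have ha : 4 ≤ a := by exact_mod_cast hα
  have haR : (4 : ℝ) ≤ a := by exact_mod_cast ha
  simp only [Int.cast_natCast] at hxα hdeg
  have hpos : ∀ e, 0 < x e := fun e => lt_of_le_of_ne (hx.1.1 e).1 (hx0 e).symm
  have hlt1 : ∀ e, x e < 1 := fun e =>
    (hxα e).trans_le ((div_le_one (by linarith)).2 (by linarith))
  obtain ⟨L, hlam, htight, hinj, hspan⟩ := exists_stronglyLaminar_tight hf hpos hx.1.2.1
  set T := B.filter fun v => ∑ e ∈ uDeg ep1 ep2 v, x e = b v with hT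
  have hcard : Fintype.card E ≤ L.card + T.card := by
    refine card_le_of_sum_eq_zero (ep1 := ep1) (ep2 := ep2) fun y hyL hyT =>
      eq_zero_of_mem_extremePoints hx hpos hlt1 y (fun A hA => ?_) fun v hv hvb => ?_
    · exact (isTight_or_sum_eq_zero hpos hA y).elim (hspan y hyL A) id
    · exact hyT v (Finset.mem_filter.2 ⟨hv, hvb⟩)
  set γ := gammaOf f with hγdef
  have hγ : ∀ A ∈ L, A.boundary.card ≤ γ := fun A hA =>
    Finset.le_sup (f := fun A : Biset V => A.boundary.card)
      (Finset.mem_filter.2 ⟨Finset.mem_univ A, (htight A hA).1⟩)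
  set q : ℝ := 4 * ((γ : ℝ) + 2) / ((a : ℝ) - 2) with hq
  have ha2 : (0 : ℝ) < a - 2 := by linarith
  have hq0 : 0 ≤ q := by positivity
  have hqa : q * (a - 2) = 4 * (γ + 2) := div_mul_cancel₀ _ ha2.ne'
  have hceil : 0 ≤ ⌈q⌉ := Int.ceil_nonneg hq0
  obtain ⟨D, hD⟩ : ∃ D : ℕ, (D : ℤ) = ⌈q⌉ + 6 := ⟨(⌈q⌉ + 6).toNat, by omega⟩
  have hDq : q + 6 ≤ D := by
    have h1 := Int.le_ceil q
    have h2 : (D : ℝ) = ⌈q⌉ + 6 := by exact_mod_cast hD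
    linarith
  obtain ⟨ℓ, k, hℓ, hb1, hb2⟩ := exists_token_bounds ha hpos hxα hlam htight hinj hγ
    (T := T) (D := D) (fun v hv => by
      have := hdeg v (Finset.mem_filter.1 hv).1
      omega) hcard
  have hb1' : ((a : ℝ) - 1) * (ℓ + k) ≤ 2 * ℓ + 2 * T.card := by
    have h1 : ((a - 1 : ℕ) : ℝ) = (a : ℝ) - 1 := by
      rw [Nat.cast_sub (by omega), Nat.cast_one]
    rw [← h1]
    exact_mod_cast hb1
  have hb2' : (D : ℝ) * T.card ≤ 5 * T.card + (γ + 2) * ℓ + k := by exact_mod_cast hb2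
  have hℓ0 : (0 : ℝ) ≤ ℓ := Nat.cast_nonneg _
  have hk0 : (0 : ℝ) ≤ k := Nat.cast_nonneg _
  have ht0 : (0 : ℝ) ≤ T.card := Nat.cast_nonneg _
  have hD' : (q + 6) * T.card ≤ D * T.card := mul_le_mul_of_nonneg_right hDq ht0
  have hak : 3 * (k : ℝ) ≤ (a - 1) * k := mul_le_mul_of_nonneg_right (by linarith) hk0
  have hal : (ℓ : ℝ) ≤ (a - 3) * ℓ := le_mul_of_one_le_left hℓ0 (by linarith)
  have hT2 : (a - 3 : ℝ) * ℓ ≤ 2 * T.card := by nlinarith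
  have hqT : q * ((a - 3 : ℝ) * ℓ) ≤ q * (2 * T.card) := mul_le_mul_of_nonneg_left hT2 hq0
  have hql : 2 * ((γ : ℝ) + 2) * ℓ ≤ q * ((a - 3 : ℝ) * ℓ) := by
    have : 2 * ((γ : ℝ) + 2) ≤ q * (a - 3) := by nlinarith
    nlinarith
  have hl : (ℓ : ℝ) = 0 := by nlinarith
  have hk : (k : ℝ) = 0 := by nlinarith
  have ht : (T.card : ℝ) = 0 := by
    rw [hl, hk] at hb2'
    nlinarith
  have hl' : ℓ = 0 := by exact_mod_cast hl
  have ht' : T.card = 0 := by exact_mod_cast ht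
  have hL : L.card = 0 := by
    rw [Finset.card_eq_zero]
    by_contra h
    exact (hℓ (Finset.nonempty_iff_ne_empty.2 h)).ne' hl'
  have := Fintype.card_pos (α := E)
  omega
end
end
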